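/- arXiv:2511.02033 — 2 statements merged into one kernel-verified Lean document; each statement's English description precedes it below -/
import Mathlib

section
/- For every p ≥ 1 there exists a constant c(p) > 0, depending only on p, such that for every τ > 0 and every real random variable ξ with E ξ = 0 whose distribution F belongs to the class A₁(τ), the Wasserstein p-distance satisfies W_p(F, Φ_F) ≤ c(p) τ, i.e. there exists a coupling π of F and Φ_F with (∫ |x − y|^p dπ(x,y))^{1/p} ≤ c(p) τ. -/
open MeasureTheory ProbabilityTheory

noncomputable section

/-- `φ` is the cumulant generating function (analytic logarithm of the Laplace transform,
normalized by `φ 0 = 0`) of `μ` on the disc `{z : ‖z‖ * τ < 1}`, with third derivative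
bounded by `τ · Var μ`.  This is the defining property of the class `A₁(τ)`. -/
def IsCGF (φ : ℂ → ℂ) (τ : ℝ) (μ : Measure ℝ) : Prop :=
  φ 0 = 0 ∧ ∀ z : ℂ, ‖z‖ * τ < 1 →
    Integrable (fun x : ℝ => Complex.exp (z * x)) μ ∧
    Complex.exp (φ z) = ∫ x : ℝ, Complex.exp (z * x) ∂μ ∧
    AnalyticAt ℂ φ z ∧
    ‖iteratedDeriv 3 φ z‖ ≤ τ * variance id μ

/-- The class `A₁(τ)` of distributions on `ℝ`. -/
def MemA1 (τ : ℝ) (μ : Measure ℝ) : Prop := ∃ φ : ℂ → ℂ, IsCGF φ τ μ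

/-- `π` is a coupling of `F` and `G`. -/
def IsCoupling (π : Measure (ℝ × ℝ)) (F G : Measure ℝ) : Prop :=
  π.map Prod.fst = F ∧ π.map Prod.snd = G

section aux

open Real Set Filter Topology
open scoped ENNReal NNReal


/-- Working form of the class `A₁(1)`: the Laplace transform is Gaussian up to a cubic remainder
in the exponent. -/
def CoreA (F : Measure ℝ) (v τ : ℝ) : Prop :=
  ∀ z : ℂ, ‖z‖ * τ < 1 → Integrable (fun x : ℝ => Complex.exp (z * x)) F ∧
    ∃ R : ℂ, ‖R‖ ≤ τ * v * ‖z‖ ^ 3 ∧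
      ∫ x : ℝ, Complex.exp (z * x) ∂F = Complex.exp (v * z ^ 2 / 2 + R)

lemma mv_step (ψ : ℂ → ℂ) (n : ℕ) (C r : ℝ) (hC : 0 ≤ C)
    (hd : ∀ z : ℂ, ‖z‖ < r → DifferentiableAt ℂ ψ z) (h0 : ψ 0 = 0)
    (hb : ∀ z : ℂ, ‖z‖ < r → ‖deriv ψ z‖ ≤ C * ‖z‖ ^ n) :
    ∀ z : ℂ, ‖z‖ < r → ‖ψ z‖ ≤ C * ‖z‖ ^ (n + 1) := by
  intro z hz
  have := Convex.norm_image_sub_le_of_norm_deriv_le (𝕜 := ℂ) (f := ψ) (C := C * ‖z‖ ^ n)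
    (s := Metric.closedBall (0 : ℂ) ‖z‖) (x := 0) (y := z)
    (fun x hx => hd x (lt_of_le_of_lt (by simpa using hx) hz))
    (fun x hx => (hb x (lt_of_le_of_lt (by simpa using hx) hz)).trans (by
      have : ‖x‖ ≤ ‖z‖ := by simpa using hx
      gcongr)) (convex_closedBall _ _) (by simp) (by simp)
  rw [h0, sub_zero, sub_zero] at this
  calc _ ≤ _ := this
    _ = _ := by ring

lemma core_of_cgf (φ : ℂ → ℂ) (τ : ℝ) (hτ : 0 < τ) (F : Measure ℝ) [IsProbabilityMeasure F]
    (hm : ∫ x : ℝ, x ∂F = 0) (h : IsCGF φ τ F) : CoreA F (variance id F) τ := by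
  obtain ⟨h0, h⟩ := h
  have hr : ∀ z : ℂ, ‖z‖ < 1 / τ ↔ ‖z‖ * τ < 1 := fun z => lt_div_iff₀ hτ
  have hsub : (Metric.ball (0:ℝ) (1 / τ)) ⊆ integrableExpSet id F := by
    intro t ht
    have h1 := (h (t : ℂ) (by rw [← hr]; simpa using ht)).1
    have h2 := h1.norm
    simp only [integrableExpSet, mem_setOf_eq]
    refine h2.congr (ae_of_all _ fun x => ?_)
    simp [Complex.norm_exp]
  have hIntg : (0 : ℝ) ∈ interior (integrableExpSet id F) :=
    interior_mono hsub (by rw [Metric.isOpen_ball.interior_eq]; simpa using hτ)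
  have hre : ∀ z : ℂ, ‖z‖ < 1 / τ → z.re ∈ interior (integrableExpSet id F) := fun z hz =>
    interior_mono hsub (by
      rw [Metric.isOpen_ball.interior_eq]
      simpa using lt_of_le_of_lt (Complex.abs_re_le_norm z) hz)
  have hnear : ∀ᶠ z : ℂ in 𝓝 0, ‖z‖ < 1 / τ := by
    have := Metric.ball_mem_nhds (0 : ℂ) (show 0 < 1 / τ by positivity)
    filter_upwards [this] with z hz
    simpa using hz
  have hana : ∀ z : ℂ, ‖z‖ < 1 / τ → AnalyticAt ℂ φ z := fun z hz => (h z ((hr z).1 hz)).2.2.1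
  -- derivatives of the mgf
  have hE : ∀ z : ℂ, ‖z‖ < 1 / τ → Complex.exp (φ z) = complexMGF id F z := fun z hz => by
    rw [(h z ((hr z).1 hz)).2.1]; rfl
  have hopen : ∀ z : ℂ, ‖z‖ < 1 / τ → ∀ᶠ w : ℂ in 𝓝 z, ‖w‖ < 1 / τ := fun z hz =>
    (continuous_norm.tendsto z).eventually (eventually_lt_nhds hz)
  have hD1 : ∀ z : ℂ, ‖z‖ < 1 / τ →
      ∫ x : ℝ, (x : ℂ) * Complex.exp (z * x) ∂F = Complex.exp (φ z) * deriv φ z := by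
    intro z hz
    have e1 := hasDerivAt_complexMGF (hre z hz)
    have e2 := ((hana z hz).differentiableAt.hasDerivAt).cexp
    have e3 : (fun w => Complex.exp (φ w)) =ᶠ[𝓝 z] complexMGF id F := by
      filter_upwards [hopen z hz] with w hw using hE w hw
    exact e1.unique (e2.congr_of_eventuallyEq e3.symm)
  have hp1 : deriv φ 0 = 0 := by
    have := hD1 0 (by simpa using hτ)
    simp only [zero_mul, Complex.exp_zero, mul_one, h0, one_mul] at this
    rw [← this, integral_complex_ofReal, hm]; simp
  have hp2 : deriv (deriv φ) 0 = variance id F := by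
    have e1 := hasDerivAt_integral_pow_mul_exp (X := id) (μ := F) (z := 0) (by simpa using hIntg) 1
    have e2 := (((hana 0 (by simpa using hτ)).differentiableAt.hasDerivAt).cexp).mul
      (hana 0 (by simpa using hτ)).deriv.differentiableAt.hasDerivAt
    have e3 : (fun w => Complex.exp (φ w) * deriv φ w) =ᶠ[𝓝 0]
        (fun z => ∫ x : ℝ, ((id x : ℝ) : ℂ) ^ 1 * Complex.exp (z * (id x : ℝ)) ∂F) := by
      filter_upwards [hnear] with w hw
      rw [← hD1 w hw]; simp
    have e4 := e1.unique (e2.congr_of_eventuallyEq e3.symm)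
    simp only [h0, hp1] at e4
    simp at e4
    rw [← e4]
    have : variance id F = ∫ x : ℝ, x ^ 2 ∂F := by
      rw [variance_eq_integral (by fun_prop)]
      simp [hm]
    rw [this, ← integral_complex_ofReal]
    simp
  have hv0 : 0 ≤ variance id F := variance_nonneg _ _
  set v := variance id F with hv
  have hb3 : ∀ z : ℂ, ‖z‖ < 1 / τ → ‖deriv (deriv (deriv φ)) z‖ ≤ τ * v := fun z hz => by
    have := (h z ((hr z).1 hz)).2.2.2
    simpa [iteratedDeriv_succ, iteratedDeriv_zero] using this
  have s1 := mv_step (fun z => deriv (deriv φ) z - v) 0 (τ * v) (1 / τ) (by positivity)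
    (fun z hz => ((hana z hz).deriv.deriv.differentiableAt).sub_const _) (by simp [hp2])
    (fun z hz => by simpa using hb3 z hz)
  have s2 := mv_step (fun z => deriv φ z - v * z) 1 (τ * v) (1 / τ) (by positivity)
    (fun z hz => ((hana z hz).deriv.differentiableAt).sub (by fun_prop)) (by simp [hp1])
    (fun z hz => by
      have : HasDerivAt (fun z : ℂ => deriv φ z - v * z) (deriv (deriv φ) z - v * 1) z :=
        ((hana z hz).deriv.differentiableAt.hasDerivAt).sub ((hasDerivAt_id z).const_mul _)
      rw [this.deriv, mul_one]
      exact s1 z hz)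
  have s3 := mv_step (fun z => φ z - v * z ^ 2 / 2) 2 (τ * v) (1 / τ) (by positivity)
    (fun z hz => ((hana z hz).differentiableAt).sub (by fun_prop)) (by simp [h0])
    (fun z hz => by
      have : HasDerivAt (fun z : ℂ => φ z - v * z ^ 2 / 2)
          (deriv φ z - v * ((2 : ℕ) * z ^ (2 - 1)) / 2) z :=
        ((hana z hz).differentiableAt.hasDerivAt).sub
          (((hasDerivAt_pow 2 z).const_mul _).div_const _)
      rw [this.deriv]
      convert s2 z hz using 2
      push_cast; ring)
  intro z hz
  refine ⟨(h z hz).1, φ z - v * z ^ 2 / 2, s3 z ((hr z).2 hz), ?_⟩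
  rw [← (h z hz).2.1]; congr 1; ring

lemma core_scale (F : Measure ℝ) (v τ : ℝ) (hτ : 0 < τ) (h : CoreA F v τ) :
    CoreA (F.map (fun x => x / τ)) (v / τ ^ 2) 1 := by
  intro z hz
  have hτ' : (τ : ℂ) ≠ 0 := by exact_mod_cast hτ.ne'
  obtain ⟨h1, R, hR, h2⟩ := h (z / τ) (by
    rw [norm_div, Complex.norm_real, Real.norm_of_nonneg hτ.le]
    rw [div_mul_cancel₀ _ hτ.ne']; simpa using hz)
  have e : ∀ x : ℝ, z * ((x / τ : ℝ) : ℂ) = z / τ * x := fun x => by push_cast; field_simp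
  refine ⟨?_, R, ?_, ?_⟩
  · rw [integrable_map_measure (by fun_prop) (by fun_prop)]
    refine h1.congr (ae_of_all _ fun x => ?_)
    simp [Function.comp, ← e]
  · rw [norm_div, Complex.norm_real, Real.norm_of_nonneg hτ.le] at hR
    calc _ ≤ _ := hR
      _ = _ := by field_simp
  · rw [integral_map (by fun_prop) (by fun_prop)]
    simp_rw [e]
    rw [h2]
    congr 1
    push_cast; field_simp


/-- The unnormalised smoothing kernel. -/
def ker0 (a W : ℝ) (j : ℕ) (y : ℝ) : ℝ := sinc (a * y) ^ j * exp (-(1 / (2 * W ^ 2)) * y ^ 2)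

lemma ker0_cont (a W : ℝ) (j : ℕ) : Continuous (ker0 a W j) := by
  unfold ker0; fun_prop

lemma ker0_abs_le (a W : ℝ) (j : ℕ) (y : ℝ) :
    |ker0 a W j y| ≤ exp (-(1 / (2 * W ^ 2)) * y ^ 2) := by
  unfold ker0
  rw [abs_mul, abs_pow, abs_of_pos (exp_pos _)]
  exact mul_le_of_le_one_left (exp_pos _).le (pow_le_one₀ (abs_nonneg _) (abs_sinc_le_one _))

lemma ker0_exp_int (a W : ℝ) (hW : 0 < W) (j : ℕ) (z : ℂ) :
    Integrable (fun y : ℝ => (ker0 a W j y : ℂ) * Complex.exp (z * y)) := by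
  have h := integrable_cexp_quadratic' (b := ((-(1 / (2 * W ^ 2)) : ℝ) : ℂ))
    (by rw [Complex.ofReal_re]; have : 0 < 1 / (2 * W ^ 2) := by positivity
        linarith) z 0
  refine h.mono ((Complex.continuous_ofReal.comp (ker0_cont a W j)).mul
    (by fun_prop)).aestronglyMeasurable (ae_of_all _ fun y => ?_)
  rw [norm_mul, Complex.norm_real, add_zero, Complex.exp_add, norm_mul]
  gcongr
  refine (ker0_abs_le a W j y).trans (le_of_eq ?_)
  rw [← Complex.ofReal_pow, ← Complex.ofReal_mul, ← Complex.ofReal_exp, Complex.norm_real,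
    Real.norm_of_nonneg (exp_pos _).le]

lemma sinc_eq_int (a : ℝ) (y : ℝ) :
    ∫ s in -a..a, Complex.exp (s * y * Complex.I) = 2 * a * sinc (a * y) := by
  by_cases hy : y = 0
  · simp [hy]; ring
  have := intervalIntegral.integral_comp_mul_right (a := -a) (b := a)
    (fun t : ℝ => Complex.exp (t * Complex.I)) hy
  simp only [Complex.ofReal_mul] at this
  rw [this, neg_mul, integral_exp_mul_I_eq_sinc]
  rw [Complex.real_smul]
  have : (y : ℂ) ≠ 0 := by exact_mod_cast hy
  push_cast
  field_simp

lemma ker0_step (a W : ℝ) (ha : 0 < a) (hW : 0 < W) (j : ℕ) (z : ℂ) :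
    ∫ y : ℝ, (ker0 a W (j + 1) y : ℂ) * Complex.exp (z * y) =
      (1 / (2 * a) : ℂ) * ∫ s in -a..a, ∫ y : ℝ, (ker0 a W j y : ℂ) *
        Complex.exp ((z + s * Complex.I) * y) := by
  have hle : -a ≤ a := by linarith
  have haC : (a : ℂ) ≠ 0 := by exact_mod_cast ha.ne'
  rw [intervalIntegral.integral_of_le hle]
  rw [← integral_integral_swap (μ := volume) (ν := volume.restrict (Ioc (-a) a))
    (f := fun (y s : ℝ) => (ker0 a W j y : ℂ) * Complex.exp ((z + s * Complex.I) * y))]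
  · rw [← integral_const_mul]
    refine integral_congr_ae (ae_of_all _ fun y => ?_)
    simp only
    have e : ∀ s : ℝ, (ker0 a W j y : ℂ) * Complex.exp ((z + s * Complex.I) * y) =
        (ker0 a W j y * Complex.exp (z * y)) * Complex.exp (s * y * Complex.I) := fun s => by
      rw [mul_assoc, ← Complex.exp_add]; congr 2; ring
    simp_rw [e]
    rw [integral_const_mul, ← intervalIntegral.integral_of_le hle, sinc_eq_int]
    unfold ker0
    push_cast
    field_simp
    ring
  · have h1 := (ker0_exp_int a W hW j z).norm.comp_fst (volume.restrict (Ioc (-a) a))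
    refine h1.mono ?_ (ae_of_all _ fun p => ?_)
    · apply Continuous.aestronglyMeasurable
      have := ker0_cont a W j
      simp only [Function.uncurry_def]
      fun_prop
    · simp only [Function.uncurry_def, norm_mul, norm_norm, Complex.norm_exp]
      simp

lemma ker0_bound (a W : ℝ) (ha : 0 < a) (hW : 0 < W) (j : ℕ) : ∀ h t : ℝ,
    ‖∫ y : ℝ, (ker0 a W j y : ℂ) * Complex.exp ((h + t * Complex.I) * y)‖ ≤
      √(2 * π) * W * exp (W ^ 2 * h ^ 2 / 2) * exp (-(W ^ 2 * (max (|t| - j * a) 0) ^ 2 / 2)) := by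
  induction j with
  | zero =>
    intro h t
    have hneg : ((-(1 / (2 * W ^ 2)) : ℝ) : ℂ).re < 0 := by
      rw [Complex.ofReal_re]; have : 0 < 1 / (2 * W ^ 2) := by positivity
      linarith
    have key := integral_cexp_quadratic hneg (h + t * Complex.I) 0
    have e : ∀ y : ℝ, (ker0 a W 0 y : ℂ) * Complex.exp ((h + t * Complex.I) * y) =
        Complex.exp (((-(1 / (2 * W ^ 2)) : ℝ) : ℂ) * y ^ 2 + (h + t * Complex.I) * y + 0) := by
      intro y
      unfold ker0
      rw [pow_zero, one_mul, add_zero, Complex.exp_add]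
      push_cast; rfl
    simp_rw [e]
    rw [key, norm_mul]
    have n1 : ‖((π : ℂ) / -((-(1 / (2 * W ^ 2)) : ℝ) : ℂ)) ^ (1 / 2 : ℂ)‖ = √(2 * π) * W := by
      have : ((π : ℂ) / -((-(1 / (2 * W ^ 2)) : ℝ) : ℂ)) = ((2 * π * W ^ 2 : ℝ) : ℂ) := by
        push_cast
        have : (W : ℂ) ≠ 0 := by exact_mod_cast hW.ne'
        field_simp
      rw [this, Complex.norm_cpow_eq_rpow_re_of_pos (by positivity)]
      have : ((1 / 2 : ℂ)).re = 1 / 2 := by norm_num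
      rw [this, ← Real.sqrt_eq_rpow, Real.sqrt_mul (by positivity), Real.sqrt_sq hW.le]
    rw [n1, mul_assoc (√(2 * π) * W)]
    gcongr
    rw [Complex.norm_exp, ← exp_add]
    apply le_of_eq
    congr 1
    have : (0 - ((h : ℂ) + t * Complex.I) ^ 2 / (4 * ((-(1 / (2 * W ^ 2)) : ℝ) : ℂ))) =
        ((W ^ 2 * h ^ 2 / 2 - W ^ 2 * t ^ 2 / 2 : ℝ) : ℂ) +
          ((W ^ 2 * h * t : ℝ) : ℂ) * Complex.I := by
      push_cast
      have : (W : ℂ) ≠ 0 := by exact_mod_cast hW.ne'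
      field_simp
      ring_nf
      rw [Complex.I_sq]
      ring
    rw [this, Complex.add_re, Complex.re_ofReal_mul, Complex.ofReal_re, Complex.I_re]
    have : max (|t| - ((0 : ℕ) : ℝ) * a) 0 = |t| := by simp
    rw [this, sq_abs]
    ring
  | succ j ih =>
    intro h t
    rw [ker0_step a W ha hW, norm_mul]
    set B := √(2 * π) * W * exp (W ^ 2 * h ^ 2 / 2) *
      exp (-(W ^ 2 * (max (|t| - ((j + 1 : ℕ) : ℝ) * a) 0) ^ 2 / 2)) with hB
    have : ‖∫ s in -a..a, ∫ y : ℝ, (ker0 a W j y : ℂ) *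
        Complex.exp (((h + t * Complex.I) + s * Complex.I) * y)‖ ≤ B * |a - -a| := by
      apply intervalIntegral.norm_integral_le_of_norm_le_const
      intro s hs
      rw [uIoc_of_le (by linarith)] at hs
      have e : ((h : ℂ) + t * Complex.I) + s * Complex.I = h + ((t + s : ℝ) : ℂ) * Complex.I := by
        push_cast; ring
      simp_rw [e]
      refine (ih h (t + s)).trans ?_
      rw [hB]
      have h1 : |t| ≤ |t + s| + a := by
        have : |s| ≤ a := abs_le.2 ⟨hs.1.le, hs.2⟩
        have := abs_sub_abs_le_abs_sub t (-s)
        rw [sub_neg_eq_add, abs_neg] at this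
        linarith
      have h2 : |t| - ((j + 1 : ℕ) : ℝ) * a ≤ |t + s| - j * a := by push_cast; linarith
      have h3 := max_le_max_right 0 h2
      have h4 : (0 : ℝ) ≤ max (|t| - ((j + 1 : ℕ) : ℝ) * a) 0 := le_max_right _ _
      gcongr
    calc _ ≤ ‖(1 / (2 * a) : ℂ)‖ * (B * |a - -a|) := by gcongr
      _ = B := by
        have : ‖(1 / (2 * a) : ℂ)‖ = 1 / (2 * a) := by
          rw [show (1 / (2 * a) : ℂ) = ((1 / (2 * a) : ℝ) : ℂ) by push_cast; rfl,
            Complex.norm_real, Real.norm_of_nonneg (by positivity)]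
        rw [this, sub_neg_eq_add, abs_of_pos (by linarith)]
        field_simp
        ring

lemma sinc_decay (a : ℝ) (ha : 0 < a) (r : ℕ) (y : ℝ) :
    sinc (a * y) ^ (2 * r + 2) * ((1 + y ^ 2) * (1 + |y| ^ (2 * r))) ≤
      4 * (1 + (a⁻¹) ^ (2 * r + 2)) := by
  have hs0 : 0 ≤ sinc (a * y) ^ (2 * r + 2) := by
    rw [show 2 * r + 2 = 2 * (r + 1) by ring, pow_mul]; positivity
  have ha' : (0 : ℝ) ≤ (a⁻¹) ^ (2 * r + 2) := by positivity
  rcases le_or_gt |y| 1 with hy | hy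
  · have h1 : sinc (a * y) ^ (2 * r + 2) ≤ 1 := by
      rw [show 2 * r + 2 = 2 * (r + 1) by ring, pow_mul]
      exact pow_le_one₀ (sq_nonneg _) ((sq_le_one_iff_abs_le_one _).2 (abs_sinc_le_one _))
    have h2 : y ^ 2 ≤ 1 := (sq_le_one_iff_abs_le_one _).2 hy
    have h3 : |y| ^ (2 * r) ≤ 1 := pow_le_one₀ (abs_nonneg _) hy
    calc _ ≤ 1 * ((1 + 1) * (1 + 1)) := by gcongr
      _ ≤ 4 * (1 + (a⁻¹) ^ (2 * r + 2)) := by linarith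
  · have hy0 : y ≠ 0 := by rintro rfl; norm_num at hy
    have hay : |sinc (a * y)| ≤ a⁻¹ * |y|⁻¹ := by
      rw [sinc_of_ne_zero (by positivity), abs_div, abs_mul, abs_of_pos ha, div_eq_mul_inv, mul_inv]
      exact mul_le_of_le_one_left (by positivity) (abs_sin_le_one _)
    have h1 : sinc (a * y) ^ (2 * r + 2) ≤ (a⁻¹ * |y|⁻¹) ^ (2 * r + 2) := by
      rw [show 2 * r + 2 = 2 * (r + 1) by ring, pow_mul, pow_mul, ← sq_abs]
      gcongr
    have h2 : 1 + y ^ 2 ≤ 2 * |y| ^ 2 := by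
      rw [sq_abs]; have := (one_lt_sq_iff_one_lt_abs y).2 hy; linarith
    have h3 : 1 + |y| ^ (2 * r) ≤ 2 * |y| ^ (2 * r) := by
      have : 1 ≤ |y| ^ (2 * r) := one_le_pow₀ hy.le
      linarith
    calc _ ≤ (a⁻¹ * |y|⁻¹) ^ (2 * r + 2) * ((2 * |y| ^ 2) * (2 * |y| ^ (2 * r))) := by gcongr
      _ = 4 * (a⁻¹) ^ (2 * r + 2) * (|y|⁻¹ * |y|) ^ (2 * r + 2) := by
        rw [mul_pow, mul_pow]; ring
      _ = 4 * (a⁻¹) ^ (2 * r + 2) := by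
        rw [inv_mul_cancel₀ (by positivity)]; simp
      _ ≤ _ := by linarith

lemma kernel_exists (r : ℕ) : ∃ C : ℝ, 0 < C ∧ ∀ W : ℝ, 1 ≤ W → ∃ k : ℝ → ℝ, Continuous k ∧
    (∀ y, 0 ≤ k y) ∧ ∫ y, k y = 1 ∧
    (∀ y, k y * exp (|y| / W) * ((1 + y ^ 2) * (1 + |y| ^ (2 * r))) ≤ C) ∧
    ∀ h t : ℝ, |h| * W ≤ 1 → 1 / 16 ≤ |t| →
      ‖∫ y : ℝ, (k y : ℂ) * Complex.exp ((h + t * Complex.I) * y)‖ ≤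
        C * W * exp (-(W ^ 2 * t ^ 2 / 8)) := by
  set a : ℝ := 1 / (32 * (2 * r + 2)) with ha_def
  have ha : 0 < a := by positivity
  have hnn : ∀ W y : ℝ, 0 ≤ ker0 a W (2 * r + 2) y := fun W y => by
    unfold ker0
    rw [show 2 * r + 2 = 2 * (r + 1) by ring, pow_mul]; positivity
  have hIntg : ∀ W : ℝ, 0 < W → Integrable (ker0 a W (2 * r + 2)) := fun W hW => by
    have := (ker0_exp_int a W hW (2 * r + 2) 0).re
    simpa using this
  set Z : ℝ → ℝ := fun W => ∫ y, ker0 a W (2 * r + 2) y with hZ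
  have hZ1 : 0 < Z 1 := by
    rw [hZ]
    simp only
    rw [integral_pos_iff_support_of_nonneg (hnn 1) (hIntg 1 one_pos)]
    exact ((ker0_cont a 1 (2 * r + 2)).isOpen_support).measure_pos volume ⟨0, by simp [ker0]⟩
  have hZW : ∀ W : ℝ, 1 ≤ W → Z 1 ≤ Z W := fun W hW => by
    apply integral_mono (hIntg 1 one_pos) (hIntg W (by linarith))
    intro y
    unfold ker0
    have : (0:ℝ) ≤ sinc (a * y) ^ (2 * r + 2) := by
      rw [show 2 * r + 2 = 2 * (r + 1) by ring, pow_mul]; positivity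
    simp only
    gcongr
  set C1 := 4 * (1 + (a⁻¹) ^ (2 * r + 2)) * exp (1 / 2) with hC1
  set C2 := √(2 * π) * exp (1 / 2) with hC2
  have hC1p : 0 < C1 := by positivity
  have hC2p : 0 < C2 := by positivity
  refine ⟨(C1 + C2) / Z 1, by positivity, fun W hW => ?_⟩
  have hW0 : 0 < W := by linarith
  have hZp : 0 < Z W := hZ1.trans_le (hZW W hW)
  refine ⟨fun y => ker0 a W (2 * r + 2) y / Z W, (ker0_cont _ _ _).div_const _,
    fun y => div_nonneg (hnn W y) hZp.le, ?_, ?_, ?_⟩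
  · rw [integral_div]; exact div_self hZp.ne'
  · intro y
    have h1 : ker0 a W (2 * r + 2) y * exp (|y| / W) * ((1 + y ^ 2) * (1 + |y| ^ (2 * r))) ≤ C1 := by
      have e1 : exp (-(1 / (2 * W ^ 2)) * y ^ 2) * exp (|y| / W) ≤ exp (1 / 2) := by
        rw [← exp_add]
        apply exp_le_exp.2
        rw [← sq_abs y]
        have : 0 ≤ (|y| / W - 1) ^ 2 := sq_nonneg _
        have e : -(1 / (2 * W ^ 2)) * |y| ^ 2 = - (|y| / W) ^ 2 / 2 := by
          field_simp
        rw [e]; nlinarith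
      calc _ = (sinc (a * y) ^ (2 * r + 2) * ((1 + y ^ 2) * (1 + |y| ^ (2 * r)))) *
            (exp (-(1 / (2 * W ^ 2)) * y ^ 2) * exp (|y| / W)) := by unfold ker0; ring
        _ ≤ _ := by
          rw [hC1]
          exact mul_le_mul (sinc_decay a ha r y) e1 (by positivity) (by positivity)
    calc _ = (ker0 a W (2 * r + 2) y * exp (|y| / W) * ((1 + y ^ 2) * (1 + |y| ^ (2 * r)))) / Z W := by
          ring
      _ ≤ (C1 + C2) / Z 1 := by
        have := hZW W hW
        gcongr
        linarith
  · intro h t hh ht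
    have e : ∀ y : ℝ, ((ker0 a W (2 * r + 2) y / Z W : ℝ) : ℂ) *
        Complex.exp ((h + t * Complex.I) * y) =
        (ker0 a W (2 * r + 2) y : ℂ) * Complex.exp ((h + t * Complex.I) * y) / (Z W : ℂ) :=
      fun y => by push_cast; ring
    simp_rw [e]
    rw [integral_div, norm_div, Complex.norm_real, Real.norm_of_nonneg hZp.le]
    have h1 := ker0_bound a W ha hW0 (2 * r + 2) h t
    have hja : ((2 * r + 2 : ℕ) : ℝ) * a = 1 / 32 := by
      rw [ha_def]; push_cast; field_simp
    rw [hja] at h1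
    have hmax : |t| / 2 ≤ max (|t| - 1 / 32) 0 := le_max_of_le_left (by linarith)
    have hWh : W ^ 2 * h ^ 2 ≤ 1 := by
      rw [← sq_abs h, ← mul_pow, mul_comm W]
      exact pow_le_one₀ (by positivity) hh
    have h2 : ‖∫ y : ℝ, (ker0 a W (2 * r + 2) y : ℂ) * Complex.exp ((h + t * Complex.I) * y)‖ ≤
        C2 * W * exp (-(W ^ 2 * t ^ 2 / 8)) := by
      refine h1.trans ?_
      have e1 : exp (W ^ 2 * h ^ 2 / 2) ≤ exp (1 / 2) := by gcongr
      have e2 : exp (-(W ^ 2 * (max (|t| - 1 / 32) 0) ^ 2 / 2)) ≤ exp (-(W ^ 2 * t ^ 2 / 8)) := by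
        have : t ^ 2 / 4 ≤ (max (|t| - 1 / 32) 0) ^ 2 := by
          rw [← sq_abs t]
          calc |t| ^ 2 / 4 = (|t| / 2) ^ 2 := by ring
            _ ≤ _ := by gcongr
        apply exp_le_exp.2
        nlinarith [sq_nonneg W]
      calc _ ≤ √(2 * π) * W * exp (1 / 2) * exp (-(W ^ 2 * t ^ 2 / 8)) := by gcongr
        _ = _ := by rw [hC2]; ring
    calc _ ≤ (C2 * W * exp (-(W ^ 2 * t ^ 2 / 8))) / Z W := by gcongr
      _ ≤ ((C1 + C2) * W * exp (-(W ^ 2 * t ^ 2 / 8))) / Z 1 := by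
        have := hZW W hW
        gcongr
        linarith
      _ = _ := by ring


/-- The properties of the smoothing kernel that are used below. -/
structure IsKer (C W : ℝ) (r : ℕ) (k : ℝ → ℝ) : Prop where
  cont : Continuous k
  nn : ∀ y, 0 ≤ k y
  int1 : ∫ y, k y = 1
  dec : ∀ y, k y * exp (|y| / W) * ((1 + y ^ 2) * (1 + |y| ^ (2 * r))) ≤ C
  four : ∀ h t : ℝ, |h| * W ≤ 1 → 1 / 16 ≤ |t| →
      ‖∫ y : ℝ, (k y : ℂ) * Complex.exp ((h + t * Complex.I) * y)‖ ≤
        C * W * exp (-(W ^ 2 * t ^ 2 / 8))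

/-- Laplace transform of the kernel. -/
def khat (k : ℝ → ℝ) (h t : ℝ) : ℂ :=
  ∫ y : ℝ, (k y : ℂ) * Complex.exp ((h + t * Complex.I) * y)

lemma IsKer.dec' {C W : ℝ} {r : ℕ} {k : ℝ → ℝ} (H : IsKer C W r k) (y : ℝ) :
    k y * exp (|y| / W) * (1 + |y| ^ (2 * r)) ≤ C * (1 + y ^ 2)⁻¹ := by
  have : (0:ℝ) < 1 + y ^ 2 := by positivity
  rw [le_mul_inv_iff₀ this]
  calc _ = _ := by ring
    _ ≤ _ := H.dec y

lemma IsKer.dec'' {C W : ℝ} {r : ℕ} {k : ℝ → ℝ} (H : IsKer C W r k) (y : ℝ) :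
    k y * exp (|y| / W) ≤ C * (1 + y ^ 2)⁻¹ := by
  refine le_trans ?_ (H.dec' y)
  have := H.nn y
  apply le_mul_of_one_le_right (by positivity)
  have : 0 ≤ |y| ^ (2 * r) := by positivity
  linarith

lemma exp_hy_le {W h : ℝ} (hW : 1 ≤ W) (hh : |h| * W ≤ 1) (y : ℝ) :
    |h * y| ≤ |y| / W := by
  have : 0 < W := by linarith
  rw [abs_mul, le_div_iff₀ this]
  nlinarith [abs_nonneg y, abs_nonneg h]

lemma norm_cexp_ht (h t y : ℝ) : ‖Complex.exp ((h + t * Complex.I) * y)‖ = exp (h * y) := by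
  rw [Complex.norm_exp]; simp

lemma IsKer.norm_le {C W : ℝ} {r : ℕ} {k : ℝ → ℝ} (H : IsKer C W r k) (hW : 1 ≤ W)
    {h : ℝ} (t : ℝ) (hh : |h| * W ≤ 1) (y : ℝ) :
    ‖(k y : ℂ) * Complex.exp ((h + t * Complex.I) * y)‖ ≤ C * (1 + y ^ 2)⁻¹ := by
  rw [norm_mul, norm_cexp_ht, Complex.norm_real, Real.norm_of_nonneg (H.nn y)]
  refine le_trans ?_ (H.dec'' y)
  have := H.nn y
  gcongr
  exact (le_abs_self _).trans (exp_hy_le hW hh y)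

lemma IsKer.integrable {C W : ℝ} {r : ℕ} {k : ℝ → ℝ} (H : IsKer C W r k) (hW : 1 ≤ W)
    {h : ℝ} (t : ℝ) (hh : |h| * W ≤ 1) :
    Integrable fun y : ℝ => (k y : ℂ) * Complex.exp ((h + t * Complex.I) * y) := by
  have hk := H.cont
  exact (integrable_inv_one_add_sq.const_mul C).mono' (by fun_prop)
    (ae_of_all _ fun y => H.norm_le hW t hh y)

lemma IsKer.khat_le {C W : ℝ} {r : ℕ} {k : ℝ → ℝ} (H : IsKer C W r k) (hW : 1 ≤ W)
    {h : ℝ} (t : ℝ) (hh : |h| * W ≤ 1) : ‖khat k h t‖ ≤ C * π := by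
  refine (norm_integral_le_of_norm_le (integrable_inv_one_add_sq.const_mul C)
    (ae_of_all _ fun y => H.norm_le hW t hh y)).trans (le_of_eq ?_)
  rw [integral_const_mul, integral_univ_inv_one_add_sq]

lemma IsKer.kint {C W : ℝ} {r : ℕ} {k : ℝ → ℝ} (H : IsKer C W r k) : Integrable k := by
  by_contra h
  have := H.int1
  rw [integral_undef h] at this
  norm_num at this

lemma IsKer.khat_sub_one {C W : ℝ} {r : ℕ} {k : ℝ → ℝ} (H : IsKer C W r k) (hW : 1 ≤ W)
    (hr : 1 ≤ r) {h : ℝ} (t : ℝ) (hh : |h| * W ≤ 1) :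
    ‖khat k h t - 1‖ ≤ C * π * (|h| + |t|) := by
  have e1 : (1 : ℂ) = ∫ y : ℝ, (k y : ℂ) := by
    rw [integral_complex_ofReal, H.int1]; simp
  unfold khat
  have hki : Integrable (fun y : ℝ => (k y : ℂ)) := H.kint.ofReal
  rw [e1, ← integral_sub (H.integrable hW t hh) hki]
  have hb : ∀ y : ℝ, ‖(k y : ℂ) * Complex.exp ((h + t * Complex.I) * y) - k y‖ ≤
      (C * (|h| + |t|)) * (1 + y ^ 2)⁻¹ := by
    intro y
    have s1 : Complex.exp ((h + t * Complex.I) * y) - 1 =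
        Complex.exp ((h * y : ℝ) : ℂ) * (Complex.exp (Complex.I * ((t * y : ℝ) : ℂ)) - 1) +
          (Complex.exp ((h * y : ℝ) : ℂ) - 1) := by
      rw [mul_sub, ← Complex.exp_add]
      push_cast
      ring_nf
    have s2 : ‖Complex.exp ((h + t * Complex.I) * y) - 1‖ ≤ (|h| + |t|) * |y| * exp (|y| / W) := by
      rw [s1]
      have hle := exp_hy_le hW hh y
      have a1 : ‖Complex.exp ((h * y : ℝ) : ℂ)‖ ≤ exp (|y| / W) := by
        rw [← Complex.ofReal_exp, Complex.norm_real, Real.norm_of_nonneg (exp_pos _).le]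
        exact exp_le_exp.2 ((le_abs_self _).trans hle)
      have a2 : ‖Complex.exp (Complex.I * ((t * y : ℝ) : ℂ)) - 1‖ ≤ |t| * |y| := by
        have := Real.norm_exp_I_mul_ofReal_sub_one_le (x := t * y)
        rwa [Real.norm_eq_abs, abs_mul] at this
      have a3 : ‖Complex.exp ((h * y : ℝ) : ℂ) - 1‖ ≤ |h| * |y| * exp (|y| / W) := by
        have := Complex.norm_exp_sub_sum_le_norm_mul_exp ((h * y : ℝ) : ℂ) 1
        simp only [Finset.range_one, Finset.sum_singleton, pow_zero, Nat.factorial_zero,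
          Nat.cast_one, div_one, pow_one, Complex.norm_real, Real.norm_eq_abs] at this
        refine this.trans ?_
        rw [abs_mul]
        rw [abs_mul] at hle
        gcongr
      calc _ ≤ _ := norm_add_le _ _
        _ ≤ exp (|y| / W) * (|t| * |y|) + |h| * |y| * exp (|y| / W) := by
          rw [norm_mul]; gcongr
        _ = _ := by ring
    have s3 : |y| ≤ 1 + |y| ^ (2 * r) := by
      rcases le_or_gt |y| 1 with h1 | h1
      · have : 0 ≤ |y| ^ (2 * r) := by positivity
        linarith
      · have : |y| ^ 1 ≤ |y| ^ (2 * r) := pow_le_pow_right₀ h1.le (by omega)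
        linarith
    have s4 := H.dec' y
    have hk := H.nn y
    calc ‖(k y : ℂ) * Complex.exp ((h + t * Complex.I) * y) - k y‖
        = k y * ‖Complex.exp ((h + t * Complex.I) * y) - 1‖ := by
          rw [show (k y : ℂ) * Complex.exp ((h + t * Complex.I) * y) - k y =
            (k y : ℂ) * (Complex.exp ((h + t * Complex.I) * y) - 1) by ring, norm_mul,
            Complex.norm_real, Real.norm_of_nonneg hk]
      _ ≤ k y * ((|h| + |t|) * (1 + |y| ^ (2 * r)) * exp (|y| / W)) := by
          refine mul_le_mul_of_nonneg_left (s2.trans ?_) hk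
          gcongr
      _ = (|h| + |t|) * (k y * exp (|y| / W) * (1 + |y| ^ (2 * r))) := by ring
      _ ≤ (|h| + |t|) * (C * (1 + y ^ 2)⁻¹) := by gcongr
      _ = _ := by ring
  refine (norm_integral_le_of_norm_le (integrable_inv_one_add_sq.const_mul _)
    (ae_of_all _ hb)).trans (le_of_eq ?_)
  rw [integral_const_mul, integral_univ_inv_one_add_sq]; ring

lemma IsKer.Cpos {C W : ℝ} {r : ℕ} {k : ℝ → ℝ} (H : IsKer C W r k) : 0 ≤ C := by
  have := H.dec 0
  have h2 := H.nn 0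
  refine le_trans ?_ this
  positivity

lemma IsKer.khat_cont {C W : ℝ} {r : ℕ} {k : ℝ → ℝ} (H : IsKer C W r k) (hW : 1 ≤ W)
    {h : ℝ} (hh : |h| * W ≤ 1) : Continuous (khat k h) := by
  have hk := H.cont
  unfold khat
  exact continuous_of_dominated (fun t => by fun_prop)
    (fun t => ae_of_all _ fun y => H.norm_le hW t hh y)
    (integrable_inv_one_add_sq.const_mul C) (ae_of_all _ fun y => by fun_prop)

lemma IsKer.khat_integrable {C W : ℝ} {r : ℕ} {k : ℝ → ℝ} (H : IsKer C W r k) (hW : 1 ≤ W)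
    {h : ℝ} (hh : |h| * W ≤ 1) : Integrable (khat k h) := by
  have hC := H.Cpos
  have hW2 : 0 < W ^ 2 / 8 := by positivity
  have i1 : Integrable fun t : ℝ => (C * W + C * π * exp (W ^ 2 / 8 )) *
      exp (-(W ^ 2 / 8) * t ^ 2) := (integrable_exp_neg_mul_sq hW2).const_mul _
  refine i1.mono' (H.khat_cont hW hh).aestronglyMeasurable (ae_of_all _ fun t => ?_)
  have hW0 : 0 ≤ W := by linarith
  rcases le_or_gt (1 / 16) |t| with ht | ht
  · refine (H.four h t hh ht).trans ?_
    rw [show -(W ^ 2 * t ^ 2 / 8) = -(W ^ 2 / 8) * t ^ 2 by ring]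
    gcongr
    have : 0 ≤ C * π * exp (W ^ 2 / 8) := by positivity
    linarith
  · refine (H.khat_le hW t hh).trans ?_
    rw [add_mul, mul_assoc (C * π), ← exp_add]
    have h1 : 1 ≤ exp (W ^ 2 / 8 + -(W ^ 2 / 8) * t ^ 2) := by
      apply one_le_exp
      have : t ^ 2 ≤ 1 := (sq_le_one_iff_abs_le_one _).2 (by linarith)
      nlinarith
    have h2 : C * π ≤ C * π * exp (W ^ 2 / 8 + -(W ^ 2 / 8) * t ^ 2) :=
      le_mul_of_one_le_right (by positivity) h1
    have h3 : 0 ≤ C * W * exp (-(W ^ 2 / 8) * t ^ 2) := by positivity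
    linarith

lemma IsKer.inversion {C W : ℝ} {r : ℕ} {k : ℝ → ℝ} (H : IsKer C W r k) (hW : 1 ≤ W)
    {h : ℝ} (hh : |h| * W ≤ 1) (y : ℝ) :
    (k y : ℂ) = (1 / (2 * π) : ℝ) *
      ∫ t : ℝ, khat k h t * Complex.exp (-((h + t * Complex.I) * y)) := by
  have hk := H.cont
  set g : ℝ → ℂ := fun y => (k y : ℂ) * Complex.exp (h * y) with hg
  have hgc : Continuous g := by fun_prop
  have hgi : Integrable g := by
    have := H.integrable hW 0 hh
    simpa using this
  have hF : ∀ w : ℝ, FourierTransform.fourier g w = khat k h (-(2 * π) * w) := by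
    intro w
    rw [Real.fourier_real_eq_integral_exp_smul]
    unfold khat
    refine integral_congr_ae (ae_of_all _ fun x => ?_)
    simp only [hg, smul_eq_mul]
    rw [mul_left_comm, ← Complex.exp_add]
    congr 2
    push_cast; ring
  have h2pi : (-(2 * π)) ≠ 0 := by have := pi_pos; linarith
  have hFi : Integrable (FourierTransform.fourier g) := by
    rw [show FourierTransform.fourier g = fun w : ℝ => khat k h (-(2 * π) * w) from funext hF]
    exact (H.khat_integrable hW hh).comp_mul_left' h2pi
  have hinv := congrFun (hgc.fourierInv_fourier_eq hgi hFi) y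
  rw [Real.fourierInv_eq_fourier_neg, Real.fourier_real_eq_integral_exp_smul] at hinv
  simp_rw [hF] at hinv
  have e1 : ∀ w : ℝ, Complex.exp (((-2 * π * w * -y : ℝ) : ℂ) * Complex.I) • khat k h (-(2 * π) * w)
      = (fun t : ℝ => khat k h t * Complex.exp (-(t * Complex.I * y))) (-(2 * π) * w) := by
    intro w
    simp only [smul_eq_mul]
    rw [mul_comm]
    congr 2
    push_cast; ring
  simp_rw [e1] at hinv
  rw [Measure.integral_comp_mul_left (fun t : ℝ => khat k h t * Complex.exp (-(t * Complex.I * y)))]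
    at hinv
  have e2 : |(-(2 * π))⁻¹| = 1 / (2 * π) := by
    rw [abs_inv, abs_neg, abs_of_pos (by positivity)]; simp
  rw [e2, Complex.real_smul] at hinv
  have e3 : ∀ t : ℝ, khat k h t * Complex.exp (-((h + t * Complex.I) * y)) =
      Complex.exp (-(h * y)) * (khat k h t * Complex.exp (-(t * Complex.I * y))) := by
    intro t
    rw [mul_left_comm, ← Complex.exp_add]
    congr 2; ring
  simp_rw [e3]
  rw [integral_const_mul, mul_left_comm, hinv, hg]
  simp only
  rw [mul_left_comm, ← Complex.exp_add]
  simp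

lemma IsKer.density {C W : ℝ} {r : ℕ} {k : ℝ → ℝ} (H : IsKer C W r k) (hW : 1 ≤ W)
    {h : ℝ} (hh : |h| * W ≤ 1) (F : Measure ℝ) [IsProbabilityMeasure F]
    (hF : Integrable (fun x : ℝ => exp (h * x)) F) (x : ℝ) :
    ((∫ y, k (x - y) ∂F : ℝ) : ℂ) = (1 / (2 * π) : ℝ) *
      ∫ t : ℝ, khat k h t * Complex.exp (-((h + t * Complex.I) * x)) *
        ∫ y : ℝ, Complex.exp ((h + t * Complex.I) * y) ∂F := by
  have hkc := H.khat_cont hW hh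
  rw [← integral_complex_ofReal]
  simp_rw [H.inversion hW hh]
  rw [integral_const_mul]
  congr 1
  rw [integral_integral_swap]
  · refine integral_congr_ae (ae_of_all _ fun t => ?_)
    simp only
    rw [← integral_const_mul]
    refine integral_congr_ae (ae_of_all _ fun y => ?_)
    simp only
    rw [mul_assoc, ← Complex.exp_add]
    congr 2
    push_cast; ring
  · have h1 := hF.mul_prod (((H.khat_integrable hW hh).norm).const_mul (exp (-(h * x))))
    refine h1.mono' ?_ (ae_of_all _ fun p => ?_)
    · apply Continuous.aestronglyMeasurable
      simp only [Function.uncurry_def]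
      fun_prop
    · simp only [Function.uncurry_def]
      rw [norm_mul, Complex.norm_exp]
      apply le_of_eq
      have : (-(((h : ℂ) + (p.2 : ℂ) * Complex.I) * ((x - p.1 : ℝ) : ℂ))).re = h * p.1 + (-(h * x)) := by
        simp; ring
      rw [this, exp_add]
      ring


/-- Centered Gaussian density with standard deviation `σ`. -/
def gs (σ x : ℝ) : ℝ := exp (-(x ^ 2 / (2 * σ ^ 2))) / (σ * √(2 * π))

lemma two_cube (a b : ℝ) (ha : 0 ≤ a) (hb : 0 ≤ b) : (a + b) ^ 3 ≤ 4 * a ^ 3 + 4 * b ^ 3 := by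
  nlinarith [mul_nonneg (add_nonneg ha hb) (sq_nonneg (a - b))]

lemma le_one_cube (a : ℝ) (ha : 0 ≤ a) : a ≤ 1 + a ^ 3 := by
  rcases le_or_gt a 1 with h | h
  · have : 0 ≤ a ^ 3 := by positivity
    linarith
  · nlinarith [mul_pos (show 0 < a by linarith) (show 0 < a - 1 by linarith), sq_nonneg (a-1)]

/-- The integrand of the difference of densities. -/
def dint (k : ℝ → ℝ) (F : Measure ℝ) (σ x t : ℝ) : ℂ :=
  khat k (x / σ ^ 2) t * Complex.exp (-(((x / σ ^ 2 : ℝ) + t * Complex.I) * x)) *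
        (∫ y : ℝ, Complex.exp (((x / σ ^ 2 : ℝ) + t * Complex.I) * y) ∂F)
   - ((exp (-(x ^ 2 / (2 * σ ^ 2))) * exp (-(σ ^ 2 / 2) * t ^ 2) : ℝ) : ℂ)

lemma dint_small {C L : ℝ} {r : ℕ} {k : ℝ → ℝ} (H : IsKer C (L ^ 2) r k) (hr : 1 ≤ r)
    (hL : 2 ≤ L) (σ : ℝ) (hσ : σ = L ^ 3)
    (F : Measure ℝ) (hF : CoreA F (σ ^ 2) 1) (x : ℝ) (hx : |x| ≤ σ * L) (t : ℝ)
    (ht : |t| < 1 / 16) :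
    ‖dint k F σ x t‖ ≤ exp (-(x ^ 2 / (2 * σ ^ 2))) * (1 + |x / σ| ^ 3) *
      ((C * π * (4 * exp 4 + 2)) / σ * ((1 + |σ * t| ^ 3) * exp (-(1 / 4) * (σ * t) ^ 2))) := by
  have hC := H.Cpos
  have hσ0 : 0 < σ := by rw [hσ]; positivity
  have hW : 1 ≤ L ^ 2 := by nlinarith
  set h := x / σ ^ 2 with hh
  set u := |x / σ| with hu
  set s := |σ * t| with hs
  have hu0 : 0 ≤ u := abs_nonneg _
  have hs0 : 0 ≤ s := abs_nonneg _
  have huL : u ≤ L := by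
    rw [hu, abs_div, abs_of_pos hσ0, div_le_iff₀ hσ0]; linarith
  have hhu : |h| = u / σ := by
    rw [hh, hu, abs_div, abs_div, abs_of_pos hσ0, abs_of_pos (by positivity : 0 < σ ^ 2)]
    field_simp
  have hts : |t| = s / σ := by
    rw [hs, abs_mul, abs_of_pos hσ0]; field_simp
  have hhW : |h| * L ^ 2 ≤ 1 := by
    rw [hhu, hσ, div_mul_eq_mul_div, div_le_one (by positivity)]
    nlinarith [sq_nonneg L]
  have hh4 : |h| ≤ 1 / 4 := by nlinarith [abs_nonneg h]
  have hz : ‖(h : ℂ) + t * Complex.I‖ ≤ |h| + |t| := by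
    refine (norm_add_le _ _).trans ?_
    simp
  obtain ⟨-, R, hR, hM⟩ := hF (h + t * Complex.I) (by linarith)
  have hu3 : u ^ 3 / σ ≤ 1 := by
    rw [div_le_one hσ0, hσ]; gcongr
  have hRn : ‖R‖ ≤ (4 * u ^ 3 + 4 * s ^ 3) / σ := by
    refine hR.trans ?_
    calc 1 * σ ^ 2 * ‖(h : ℂ) + t * Complex.I‖ ^ 3 ≤ 1 * σ ^ 2 * (|h| + |t|) ^ 3 := by gcongr
      _ ≤ 1 * σ ^ 2 * (4 * |h| ^ 3 + 4 * |t| ^ 3) := by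
        gcongr; exact two_cube _ _ (abs_nonneg _) (abs_nonneg _)
      _ = _ := by rw [hhu, hts]; field_simp
  have hs3 : s ^ 3 / σ ≤ s ^ 2 / 16 := by
    have : s ≤ σ / 16 := by
      rw [hts, div_lt_iff₀ hσ0] at ht; linarith
    rw [div_le_iff₀ hσ0]
    nlinarith [sq_nonneg s]
  have hRe : exp ‖R‖ ≤ exp 4 * exp (s ^ 2 / 4) := by
    rw [← exp_add]
    apply exp_le_exp.2
    refine hRn.trans ?_
    rw [add_div, mul_div_assoc, mul_div_assoc]
    linarith
  have hE : dint k F σ x t = ((exp (-(x ^ 2 / (2 * σ ^ 2))) * exp (-(σ ^ 2 / 2) * t ^ 2) : ℝ) : ℂ) *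
      (khat k h t * (Complex.exp R - 1) + (khat k h t - 1)) := by
    unfold dint
    rw [← hh, hM]
    have : Complex.exp (-(((h : ℝ) + t * Complex.I) * x)) *
        Complex.exp (((σ ^ 2 : ℝ) : ℂ) * ((h : ℂ) + t * Complex.I) ^ 2 / 2 + R) =
        ((exp (-(x ^ 2 / (2 * σ ^ 2))) * exp (-(σ ^ 2 / 2) * t ^ 2) : ℝ) : ℂ) * Complex.exp R := by
      push_cast
      rw [← Complex.exp_add, ← Complex.exp_add, ← Complex.exp_add]
      congr 1
      rw [hh]
      have : (σ : ℂ) ≠ 0 := by exact_mod_cast hσ0.ne'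
      push_cast
      field_simp
      ring_nf
      rw [Complex.I_sq]
      ring
    rw [mul_assoc, this]
    ring
  have hexpR : ‖Complex.exp R - 1‖ ≤ ‖R‖ * exp ‖R‖ := by
    have := Complex.norm_exp_sub_sum_le_norm_mul_exp R 1
    simpa using this
  have hk1 := H.khat_le hW t hhW
  have hk2 := H.khat_sub_one hW hr t hhW
  rw [hE, norm_mul, Complex.norm_real, Real.norm_of_nonneg (by positivity), mul_assoc, mul_assoc]
  refine mul_le_mul_of_nonneg_left ?_ (exp_pos _).le
  have e0 : exp (-(σ ^ 2 / 2) * t ^ 2) = exp (-(1 / 4) * s ^ 2) * exp (-(s ^ 2 / 4)) := by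
    rw [← exp_add, hs, sq_abs]; congr 1; ring
  have e1 : (σ * t) ^ 2 = s ^ 2 := by rw [hs, sq_abs]
  have e2 : exp (-(s ^ 2 / 4)) * exp (s ^ 2 / 4) = 1 := by rw [← exp_add]; simp
  have e3 : exp (-(s ^ 2 / 4)) ≤ 1 := by
    apply exp_le_one_iff.2; have := sq_nonneg s; linarith
  have p1 : u ^ 3 + s ^ 3 ≤ (1 + u ^ 3) * (1 + s ^ 3) := by
    have := pow_nonneg hu0 3
    have := pow_nonneg hs0 3
    have : 0 ≤ u ^ 3 * s ^ 3 := by positivity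
    linarith
  have p2 : u + s ≤ 2 * ((1 + u ^ 3) * (1 + s ^ 3)) := by
    have := pow_nonneg hu0 3
    have := pow_nonneg hs0 3
    have : 0 ≤ u ^ 3 * s ^ 3 := by positivity
    have := le_one_cube u hu0
    have := le_one_cube s hs0
    linarith
  have hnorm : ‖khat k h t * (Complex.exp R - 1) + (khat k h t - 1)‖ ≤
      C * π * ((4 * u ^ 3 + 4 * s ^ 3) / σ * (exp 4 * exp (s ^ 2 / 4))) + C * π * (u / σ + s / σ) := by
    refine (norm_add_le _ _).trans ?_
    rw [norm_mul]
    rw [hhu, hts] at hk2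
    refine add_le_add (mul_le_mul hk1 (hexpR.trans ?_) (norm_nonneg _) (by positivity)) hk2
    gcongr
  rw [e0, e1]
  calc exp (-(1 / 4) * s ^ 2) * exp (-(s ^ 2 / 4)) *
      ‖khat k h t * (Complex.exp R - 1) + (khat k h t - 1)‖
      ≤ exp (-(1 / 4) * s ^ 2) * exp (-(s ^ 2 / 4)) *
      (C * π * ((4 * u ^ 3 + 4 * s ^ 3) / σ * (exp 4 * exp (s ^ 2 / 4))) + C * π * (u / σ + s / σ)) := by
        gcongr
    _ = exp (-(1 / 4) * s ^ 2) * (C * π) / σ * ((4 * exp 4 * (u ^ 3 + s ^ 3)) *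
        (exp (-(s ^ 2 / 4)) * exp (s ^ 2 / 4)) + exp (-(s ^ 2 / 4)) * (u + s)) := by
        field_simp
    _ ≤ exp (-(1 / 4) * s ^ 2) * (C * π) / σ * ((4 * exp 4 * ((1 + u ^ 3) * (1 + s ^ 3))) *
        1 + 1 * (2 * ((1 + u ^ 3) * (1 + s ^ 3)))) := by
        rw [e2]
        gcongr
    _ = _ := by field_simp

lemma dint_large {C L : ℝ} {r : ℕ} {k : ℝ → ℝ} (H : IsKer C (L ^ 2) r k)
    (hL : 2 ≤ L) (σ : ℝ) (hσ : σ = L ^ 3)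
    (F : Measure ℝ) (hF : CoreA F (σ ^ 2) 1) (x : ℝ) (hx : |x| ≤ σ * L) (t : ℝ)
    (ht : 1 / 16 ≤ |t|) :
    ‖dint k F σ x t‖ ≤ exp (-(x ^ 2 / (2 * σ ^ 2))) * (1 + |x / σ| ^ 3) *
      ((C * exp 1 * (2 * 4096 ^ 2)) / σ ^ 2 * exp (-(1 / 16) * t ^ 2) +
       1024 / σ * ((1 + |σ * t| ^ 3) * exp (-(1 / 4) * (σ * t) ^ 2))) := by
  have hC := H.Cpos
  have hσ0 : 0 < σ := by rw [hσ]; positivity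
  have hW : 1 ≤ L ^ 2 := by nlinarith
  have hσ1 : 1 ≤ σ := by rw [hσ]; exact one_le_pow₀ (by linarith)
  set h := x / σ ^ 2 with hh
  set u := |x / σ| with hu
  have hu0 : 0 ≤ u := abs_nonneg _
  have huL : u ≤ L := by
    rw [hu, abs_div, abs_of_pos hσ0, div_le_iff₀ hσ0]; linarith
  have hhu : |h| = u / σ := by
    rw [hh, hu, abs_div, abs_div, abs_of_pos hσ0, abs_of_pos (by positivity : 0 < σ ^ 2)]
    field_simp
  have hhW : |h| * L ^ 2 ≤ 1 := by
    rw [hhu, hσ, div_mul_eq_mul_div, div_le_one (by positivity)]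
    nlinarith [sq_nonneg L]
  have hh4 : |h| ≤ 1 / 4 := by nlinarith [abs_nonneg h]
  have hu3 : u ^ 3 / σ ≤ 1 := by
    rw [div_le_one hσ0, hσ]; gcongr
  obtain ⟨-, R, hR, hM⟩ := hF (h : ℂ) (by simp; linarith)
  have hRn : ‖R‖ ≤ 1 := by
    refine hR.trans (le_trans (le_of_eq ?_) hu3)
    rw [Complex.norm_real, Real.norm_eq_abs, hhu]; field_simp
  have hMn : ‖∫ y : ℝ, Complex.exp ((h + t * Complex.I) * y) ∂F‖ ≤
      exp 1 * exp (σ ^ 2 * h ^ 2 / 2) := by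
    have a1 : ‖∫ y : ℝ, Complex.exp ((h + t * Complex.I) * y) ∂F‖ ≤ ∫ y : ℝ, exp (h * y) ∂F := by
      refine (norm_integral_le_integral_norm _).trans (le_of_eq ?_)
      simp_rw [norm_cexp_ht]
    have a2 : ((∫ y : ℝ, exp (h * y) ∂F : ℝ) : ℂ) =
        Complex.exp (((σ ^ 2 : ℝ) : ℂ) * (h : ℂ) ^ 2 / 2 + R) := by
      rw [← hM, ← integral_complex_ofReal]
      push_cast; rfl
    have a3 : ∫ y : ℝ, exp (h * y) ∂F ≤ ‖((∫ y : ℝ, exp (h * y) ∂F : ℝ) : ℂ)‖ := by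
      rw [Complex.norm_real]; exact le_abs_self _
    refine a1.trans (a3.trans ?_)
    rw [a2, Complex.norm_exp, ← exp_add]
    apply exp_le_exp.2
    rw [Complex.add_re]
    have : (((σ ^ 2 : ℝ) : ℂ) * (h : ℂ) ^ 2 / 2).re = σ ^ 2 * h ^ 2 / 2 := by
      rw [← Complex.ofReal_re (σ ^ 2 * h ^ 2 / 2)]; push_cast; rfl
    rw [this]
    have := (Complex.re_le_norm R).trans hRn
    linarith
  have hk := H.four h t hhW ht
  have hkhat : ‖khat k h t‖ ≤ C * (2 * 4096 ^ 2) / σ ^ 2 * exp (-(1 / 16) * t ^ 2) := by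
    refine hk.trans ?_
    have ht2 : 1 / 256 ≤ t ^ 2 := by rw [← sq_abs]; nlinarith
    have hW2 : 1 ≤ (L ^ 2) ^ 2 := one_le_pow₀ hW
    have b1 : exp (-((L ^ 2) ^ 2 * t ^ 2 / 8)) ≤
        exp (-(1 / 16) * t ^ 2) * exp (-((L ^ 2) ^ 2 / 4096)) := by
      rw [← exp_add]
      apply exp_le_exp.2
      nlinarith
    have b2 : L ^ 2 * exp (-((L ^ 2) ^ 2 / 4096)) ≤ (2 * 4096 ^ 2) / σ ^ 2 := by
      rw [exp_neg, hσ]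
      have : ((L ^ 2) ^ 2 / 4096) ^ 2 / 2 ≤ exp ((L ^ 2) ^ 2 / 4096) := by
        have := Real.quadratic_le_exp_of_nonneg (show 0 ≤ (L ^ 2) ^ 2 / 4096 by positivity)
        have h0 : 0 ≤ (L ^ 2) ^ 2 / 4096 := by positivity
        linarith
      rw [← div_eq_mul_inv, div_le_div_iff₀ (exp_pos _) (by positivity)]
      calc L ^ 2 * (L ^ 3) ^ 2 = (2 * 4096 ^ 2) * (((L ^ 2) ^ 2 / 4096) ^ 2 / 2) := by ring
        _ ≤ _ := by gcongr
    calc C * L ^ 2 * exp (-((L ^ 2) ^ 2 * t ^ 2 / 8))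
        ≤ C * L ^ 2 * (exp (-(1 / 16) * t ^ 2) * exp (-((L ^ 2) ^ 2 / 4096))) := by gcongr
      _ = C * exp (-(1 / 16) * t ^ 2) * (L ^ 2 * exp (-((L ^ 2) ^ 2 / 4096))) := by ring
      _ ≤ C * exp (-(1 / 16) * t ^ 2) * ((2 * 4096 ^ 2) / σ ^ 2) := by gcongr
      _ = _ := by ring
  have hxx : exp (-(h * x)) * exp (σ ^ 2 * h ^ 2 / 2) = exp (-(x ^ 2 / (2 * σ ^ 2))) := by
    rw [← exp_add, hh]; congr 1; field_simp; ring
  have hsec : exp (-(σ ^ 2 / 2) * t ^ 2) ≤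
      1024 / σ * ((1 + |σ * t| ^ 3) * exp (-(1 / 4) * (σ * t) ^ 2)) := by
    have ht2 : 1 / 256 ≤ t ^ 2 := by rw [← sq_abs]; nlinarith
    have c1 : exp (-(σ ^ 2 / 2) * t ^ 2) ≤ exp (-(σ ^ 2 / 1024)) * exp (-(1 / 4) * (σ * t) ^ 2) := by
      rw [← exp_add]
      apply exp_le_exp.2
      nlinarith [sq_nonneg σ]
    have c2 : exp (-(σ ^ 2 / 1024)) ≤ 1024 / σ := by
      rw [exp_neg, inv_eq_one_div, div_le_div_iff₀ (exp_pos _) hσ0]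
      have := Real.add_one_le_exp (σ ^ 2 / 1024)
      nlinarith
    have c3 : 0 ≤ |σ * t| ^ 3 := by positivity
    calc _ ≤ _ := c1
      _ ≤ 1024 / σ * exp (-(1 / 4) * (σ * t) ^ 2) := by gcongr
      _ ≤ _ := by
        gcongr
        exact le_mul_of_one_le_left (exp_pos _).le (by linarith)
  unfold dint
  rw [← hh]
  refine (norm_sub_le _ _).trans ?_
  rw [norm_mul, norm_mul, Complex.norm_real, Real.norm_of_nonneg (by positivity)]
  have hn : ‖Complex.exp (-(((h : ℝ) + t * Complex.I) * x))‖ = exp (-(h * x)) := by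
    rw [Complex.norm_exp]; simp
  rw [hn]
  have hu3' : 1 ≤ 1 + u ^ 3 := by have := pow_nonneg hu0 3; linarith
  calc ‖khat k h t‖ * exp (-(h * x)) * ‖∫ y : ℝ, Complex.exp ((h + t * Complex.I) * y) ∂F‖ +
        exp (-(x ^ 2 / (2 * σ ^ 2))) * exp (-(σ ^ 2 / 2) * t ^ 2)
      ≤ (C * (2 * 4096 ^ 2) / σ ^ 2 * exp (-(1 / 16) * t ^ 2)) * exp (-(h * x)) *
          (exp 1 * exp (σ ^ 2 * h ^ 2 / 2)) + exp (-(x ^ 2 / (2 * σ ^ 2))) *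
          (1024 / σ * ((1 + |σ * t| ^ 3) * exp (-(1 / 4) * (σ * t) ^ 2))) := by gcongr
    _ = (exp (-(h * x)) * exp (σ ^ 2 * h ^ 2 / 2)) * ((C * exp 1 * (2 * 4096 ^ 2)) / σ ^ 2 *
          exp (-(1 / 16) * t ^ 2)) + exp (-(x ^ 2 / (2 * σ ^ 2))) *
          (1024 / σ * ((1 + |σ * t| ^ 3) * exp (-(1 / 4) * (σ * t) ^ 2))) := by ring
    _ = exp (-(x ^ 2 / (2 * σ ^ 2))) * 1 * ((C * exp 1 * (2 * 4096 ^ 2)) / σ ^ 2 *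
          exp (-(1 / 16) * t ^ 2) +
          (1024 / σ * ((1 + |σ * t| ^ 3) * exp (-(1 / 4) * (σ * t) ^ 2)))) := by rw [hxx]; ring
    _ ≤ _ := by gcongr

lemma cube_gauss_int (b : ℝ) (hb : 0 < b) :
    Integrable (fun s : ℝ => (1 + |s| ^ 3) * exp (-b * s ^ 2)) := by
  have h1 := integrable_exp_neg_mul_sq hb
  have h2 := (integrable_rpow_mul_exp_neg_mul_sq hb (s := 3) (by norm_num)).norm
  refine (h1.add h2).congr (ae_of_all _ fun s => ?_)
  simp only [Pi.add_apply]
  rw [norm_mul, Real.norm_of_nonneg (exp_pos _).le]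
  have : ‖s ^ (3 : ℝ)‖ = |s| ^ 3 := by
    rw [show (3 : ℝ) = ((3 : ℕ) : ℝ) by norm_num, Real.rpow_natCast, Real.norm_eq_abs, abs_pow]
  rw [this]; ring

/-- Local limit theorem in the zone of moderate deviations. -/
lemma local_limit (C : ℝ) : ∃ D : ℝ, 0 ≤ D ∧ ∀ (L : ℝ) (r : ℕ) (k : ℝ → ℝ),
    IsKer C (L ^ 2) r k → 1 ≤ r → 2 ≤ L → ∀ σ : ℝ, σ = L ^ 3 → ∀ F : Measure ℝ,
    IsProbabilityMeasure F → CoreA F (σ ^ 2) 1 → ∀ x : ℝ, |x| ≤ σ * L →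
    |∫ y, k (x - y) ∂F - gs σ x| ≤ D / σ * (1 + |x / σ| ^ 3) * gs σ x := by
  rcases lt_or_ge C 0 with hC | hC
  · exact ⟨0, le_rfl, fun L r k H => absurd H.Cpos (not_le.2 hC)⟩
  set I1 := ∫ s : ℝ, (1 + |s| ^ 3) * exp (-(1 / 4) * s ^ 2) with hI1
  set I2 := ∫ t : ℝ, exp (-(1 / 16) * t ^ 2) with hI2
  set A1 := C * π * (4 * exp 4 + 2) + 1024 with hA1
  set A2 := C * exp 1 * (2 * 4096 ^ 2) with hA2
  have hI1p : 0 ≤ I1 := integral_nonneg fun s => by positivity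
  have hI2p : 0 ≤ I2 := integral_nonneg fun s => by positivity
  refine ⟨A1 * I1 + A2 * I2, by positivity, ?_⟩
  intro L r k H hr hL σ hσ F hFp hF x hx
  have hσ0 : 0 < σ := by rw [hσ]; positivity
  have hW : 1 ≤ L ^ 2 := by nlinarith
  have hhW : |x / σ ^ 2| * L ^ 2 ≤ 1 := by
    rw [abs_div, abs_of_pos (by positivity : 0 < σ ^ 2), div_mul_eq_mul_div,
      div_le_one (by positivity)]
    calc |x| * L ^ 2 ≤ σ * L * L ^ 2 := by gcongr
      _ = σ ^ 2 := by rw [hσ]; ring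
  have hh4 : |x / σ ^ 2| ≤ 1 / 4 := by nlinarith [abs_nonneg (x / σ ^ 2)]
  have hFi : Integrable (fun y : ℝ => exp (x / σ ^ 2 * y)) F := by
    have := (hF ((x / σ ^ 2 : ℝ) : ℂ) (by
      rw [Complex.norm_real, Real.norm_eq_abs]; linarith)).1.norm
    refine this.congr (ae_of_all _ fun y => ?_)
    simp only [Complex.norm_exp]
    rw [← Complex.ofReal_mul, Complex.ofReal_re]
  set E := exp (-(x ^ 2 / (2 * σ ^ 2))) with hE
  set P := E * (1 + |x / σ| ^ 3) with hP
  have hP0 : 0 ≤ P := by positivity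
  set bd : ℝ → ℝ := fun t => P * (A2 / σ ^ 2 * exp (-(1 / 16) * t ^ 2) +
       A1 / σ * ((1 + |σ * t| ^ 3) * exp (-(1 / 4) * (σ * t) ^ 2))) with hbd
  have hpt : ∀ t, ‖dint k F σ x t‖ ≤ bd t := by
    intro t
    rcases lt_or_ge |t| (1 / 16) with ht | ht
    · refine (dint_small H hr hL σ hσ F hF x hx t ht).trans ?_
      rw [hbd]
      refine mul_le_mul_of_nonneg_left ?_ hP0
      have : 0 ≤ A2 / σ ^ 2 * exp (-(1 / 16) * t ^ 2) := by positivity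
      refine le_trans ?_ (le_add_of_nonneg_left this)
      gcongr
      linarith
    · refine (dint_large H hL σ hσ F hF x hx t ht).trans ?_
      rw [hbd]
      refine mul_le_mul_of_nonneg_left ?_ hP0
      gcongr
      have : 0 ≤ C * π * (4 * exp 4 + 2) := by positivity
      linarith
  have j1 := integrable_exp_neg_mul_sq (show (0:ℝ) < 1 / 16 by norm_num)
  have j2 : Integrable (fun t : ℝ => (1 + |σ * t| ^ 3) * exp (-(1 / 4) * (σ * t) ^ 2)) :=
    (cube_gauss_int (1 / 4) (by norm_num)).comp_mul_left' hσ0.ne'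
  have hbdi : Integrable bd := ((j1.const_mul _).add (j2.const_mul _)).const_mul _
  have hbdv : ∫ t, bd t = P * ((A1 * I1 + A2 * I2) / σ ^ 2) := by
    rw [hbd]
    rw [integral_const_mul, integral_add (j1.const_mul _) (j2.const_mul _), integral_const_mul,
      integral_const_mul,
      Measure.integral_comp_mul_left (fun s : ℝ => (1 + |s| ^ 3) * exp (-(1 / 4) * s ^ 2)),
      abs_of_pos (inv_pos.2 hσ0), smul_eq_mul]
    rw [← hI1, ← hI2]
    field_simp
    ring
  have hG : Integrable (fun t : ℝ => ((E * exp (-(σ ^ 2 / 2) * t ^ 2) : ℝ) : ℂ)) :=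
    ((integrable_exp_neg_mul_sq (by positivity)).const_mul _).ofReal
  have hGv : ∫ t : ℝ, ((E * exp (-(σ ^ 2 / 2) * t ^ 2) : ℝ) : ℂ) = ((2 * π * gs σ x : ℝ) : ℂ) := by
    rw [integral_complex_ofReal, integral_const_mul, integral_gaussian]
    congr 1
    unfold gs
    rw [← hE]
    have e1 : √(π / (σ ^ 2 / 2)) = √(2 * π) / σ := by
      rw [show π / (σ ^ 2 / 2) = 2 * π / σ ^ 2 by field_simp, Real.sqrt_div (by positivity),
        Real.sqrt_sq hσ0.le]
    rw [e1]
    have e2 : √(2 * π) * √(2 * π) = 2 * π := Real.mul_self_sqrt (by positivity)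
    field_simp
    rw [sq, e2]
    ring
  have hdint_meas : AEStronglyMeasurable (fun t => dint k F σ x t) volume := by
    have hkc := H.khat_cont hW hhW
    unfold dint
    refine AEStronglyMeasurable.sub (AEStronglyMeasurable.mul ?_ ?_) hG.aestronglyMeasurable
    · exact (by fun_prop : Continuous _).aestronglyMeasurable
    · apply Continuous.aestronglyMeasurable
      refine continuous_of_dominated (fun t => by fun_prop) (fun t => ae_of_all _ fun y => ?_)
        hFi (ae_of_all _ fun y => by fun_prop)
      rw [norm_cexp_ht]
  have hdi : Integrable (fun t => dint k F σ x t) := hbdi.mono' hdint_meas (ae_of_all _ hpt)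
  have hden := H.density hW hhW F hFi x
  have hsum : ((∫ y, k (x - y) ∂F : ℝ) : ℂ) - (gs σ x : ℝ) =
      (1 / (2 * π) : ℝ) * ∫ t, dint k F σ x t := by
    have : ∫ t : ℝ, khat k (x / σ ^ 2) t *
        Complex.exp (-(((x / σ ^ 2 : ℝ) + t * Complex.I) * x)) *
        (∫ y : ℝ, Complex.exp (((x / σ ^ 2 : ℝ) + t * Complex.I) * y) ∂F) =
        (∫ t, dint k F σ x t) + ((2 * π * gs σ x : ℝ) : ℂ) := by
      rw [← hGv, ← integral_add hdi hG]
      refine integral_congr_ae (ae_of_all _ fun t => ?_)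
      simp only [dint]
      rw [sub_add_cancel]
    rw [hden, this]
    push_cast
    have : (π : ℂ) ≠ 0 := by exact_mod_cast pi_ne_zero
    field_simp
    ring
  have hnorm : |∫ y, k (x - y) ∂F - gs σ x| ≤ 1 / (2 * π) * (P * ((A1 * I1 + A2 * I2) / σ ^ 2)) := by
    rw [← hbdv, ← Real.norm_eq_abs, ← Complex.norm_real, Complex.ofReal_sub, hsum, norm_mul,
      Complex.norm_real, Real.norm_of_nonneg (by positivity)]
    gcongr
    exact norm_integral_le_of_norm_le hbdi (ae_of_all _ hpt)
  refine hnorm.trans ?_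
  have hPg : P = gs σ x * (σ * √(2 * π)) * (1 + |x / σ| ^ 3) := by
    rw [hP, hE]; unfold gs; field_simp
  have hgn : 0 ≤ gs σ x := by unfold gs; positivity
  rw [hPg]
  have h2 : √(2 * π) ≤ 2 * π := by
    rw [Real.sqrt_le_left (by positivity)]
    have := Real.pi_gt_three
    nlinarith
  calc 1 / (2 * π) * (gs σ x * (σ * √(2 * π)) * (1 + |x / σ| ^ 3) * ((A1 * I1 + A2 * I2) / σ ^ 2))
      = (√(2 * π) / (2 * π)) * ((A1 * I1 + A2 * I2) / σ * (1 + |x / σ| ^ 3) * gs σ x) := by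
        field_simp
    _ ≤ 1 * ((A1 * I1 + A2 * I2) / σ * (1 + |x / σ| ^ 3) * gs σ x) := by
        gcongr
        rw [div_le_one (by positivity)]
        exact h2
    _ = _ := one_mul _


/-- Exponential moments, real form. -/
lemma core_exp {F : Measure ℝ} {v : ℝ} (h : CoreA F v 1) {a : ℝ} (ha : |a| < 1) :
    ∫⁻ x, ENNReal.ofReal (exp (a * x)) ∂F ≤ ENNReal.ofReal (exp (v * a ^ 2 / 2 + v * |a| ^ 3)) := by
  obtain ⟨hi, R, hR, he⟩ := h (a : ℂ) (by simpa using ha)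
  have hn : ∀ x : ℝ, Complex.exp ((a : ℂ) * x) = ((exp (a * x) : ℝ) : ℂ) := by
    intro x; push_cast; rfl
  simp_rw [hn] at hi he
  have hi' : Integrable (fun x : ℝ => exp (a * x)) F := by
    exact hi.re
  rw [← ofReal_integral_eq_lintegral_ofReal hi' (ae_of_all _ fun x => (exp_pos _).le)]
  apply ENNReal.ofReal_le_ofReal
  have e1 : (∫ x, exp (a * x) ∂F) = ‖∫ x, ((exp (a * x) : ℝ) : ℂ) ∂F‖ := by
    rw [integral_complex_ofReal, Complex.norm_real, Real.norm_of_nonneg]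
    exact integral_nonneg fun x => (exp_pos _).le
  rw [e1, he, Complex.norm_exp]
  apply exp_le_exp.2
  have h2 : ((v : ℂ) * (a : ℂ) ^ 2 / 2).re = v * a ^ 2 / 2 := by
    rw [show (v : ℂ) * (a : ℂ) ^ 2 / 2 = ((v * a ^ 2 / 2 : ℝ) : ℂ) by push_cast; rfl,
      Complex.ofReal_re]
  rw [Complex.add_re, h2]
  have := (Complex.re_le_norm R).trans hR
  simp at this
  linarith

lemma core_gauss {v : ℝ} (hv : 0 ≤ v) : CoreA (gaussianReal 0 v.toNNReal) v 1 := by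
  intro z _
  have hz := complexMGF_id_gaussianReal (μ := 0) (v := v.toNNReal) z
  refine ⟨?_, 0, by simp; positivity, ?_⟩
  · have := integrable_exp_mul_gaussianReal (μ := 0) (v := v.toNNReal) z.re
    refine this.mono' (by fun_prop) (ae_of_all _ fun x => ?_)
    rw [Complex.norm_exp]; simp
  · rw [complexMGF] at hz
    simp only [id] at hz
    rw [hz]
    simp [Real.coe_toNNReal _ hv]

lemma pow_abs_le_exp (q : ℕ) (x : ℝ) :
    |x| ^ q ≤ (q.factorial : ℝ) * (exp x + exp (-x)) := by
  have h := Real.pow_div_factorial_le_exp |x| (abs_nonneg x) q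
  rw [div_le_iff₀ (by positivity)] at h
  have h2 : exp |x| ≤ exp x + exp (-x) := by
    rcases abs_cases x with ⟨h, _⟩ | ⟨h, _⟩ <;> rw [h] <;> linarith [exp_pos x, exp_pos (-x)]
  calc |x| ^ q ≤ exp |x| * q.factorial := h
    _ ≤ _ := by rw [mul_comm]; gcongr

lemma core_two {F : Measure ℝ} {v : ℝ} (h : CoreA F v 1) {s : ℝ} (hs : 1 < s) :
    ∫⁻ x, ENNReal.ofReal (exp (x / s) + exp (-(x / s))) ∂F ≤
      ENNReal.ofReal (2 * exp (v / s ^ 2 / 2 + v / s ^ 3)) := by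
  have h0 : 0 < s := by linarith
  have hlt : |s⁻¹| < 1 := by rw [abs_of_pos (by positivity)]; exact inv_lt_one_of_one_lt₀ hs
  have h1 := core_exp h hlt
  have h2 := core_exp h (a := -s⁻¹) (by rwa [abs_neg])
  have e1 : v * s⁻¹ ^ 2 / 2 + v * |s⁻¹| ^ 3 = v / s ^ 2 / 2 + v / s ^ 3 := by
    rw [abs_of_pos (by positivity)]; field_simp
  have e2 : v * (-s⁻¹) ^ 2 / 2 + v * |-s⁻¹| ^ 3 = v / s ^ 2 / 2 + v / s ^ 3 := by
    rw [abs_neg, neg_sq, e1]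
  rw [e1] at h1
  rw [e2] at h2
  calc ∫⁻ x, ENNReal.ofReal (exp (x / s) + exp (-(x / s))) ∂F
      = ∫⁻ x, (ENNReal.ofReal (exp (s⁻¹ * x)) + ENNReal.ofReal (exp (-s⁻¹ * x))) ∂F := by
        congr 1; ext x
        rw [← ENNReal.ofReal_add (exp_pos _).le (exp_pos _).le]
        congr 3 <;> ring
    _ = _ := lintegral_add_left (by fun_prop) _
    _ ≤ _ := add_le_add h1 h2
    _ = _ := by rw [← ENNReal.ofReal_add (exp_pos _).le (exp_pos _).le]; congr 1; ring

lemma core_mom {F : Measure ℝ} {v : ℝ} (h : CoreA F v 1) {s : ℝ} (hs : 1 < s) (q : ℕ) :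
    ∫⁻ x, ENNReal.ofReal (|x / s| ^ q) ∂F ≤
      ENNReal.ofReal (q.factorial * (2 * exp (v / s ^ 2 / 2 + v / s ^ 3))) := by
  calc ∫⁻ x, ENNReal.ofReal (|x / s| ^ q) ∂F
      ≤ ∫⁻ x, ENNReal.ofReal (q.factorial : ℝ) *
          ENNReal.ofReal (exp (x / s) + exp (-(x / s))) ∂F := by
        apply lintegral_mono
        intro x
        dsimp only
        rw [← ENNReal.ofReal_mul (by positivity)]
        exact ENNReal.ofReal_le_ofReal (pow_abs_le_exp q _)
    _ = _ := lintegral_const_mul _ (by fun_prop)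
    _ ≤ _ := mul_le_mul_right (core_two h hs) _
    _ = _ := by rw [← ENNReal.ofReal_mul (by positivity)]

lemma core_expabs {F : Measure ℝ} {v : ℝ} (h : CoreA F v 1) {s : ℝ} (hs : 1 < s) :
    ∫⁻ x, ENNReal.ofReal (exp (|x| / s)) ∂F ≤
      ENNReal.ofReal (2 * exp (v / s ^ 2 / 2 + v / s ^ 3)) := by
  refine le_trans (lintegral_mono fun x => ENNReal.ofReal_le_ofReal ?_) (core_two h hs)
  have := Real.exp_abs_le (x / s)
  rwa [abs_div, abs_of_pos (by linarith : 0 < s)] at this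


lemma cdf_cont (μ : Measure ℝ) [IsProbabilityMeasure μ] [NullSingletonClass μ] : Continuous (cdf μ) := by
  rw [continuous_iff_continuousAt]
  intro x
  have hr : Function.rightLim (cdf μ) x = cdf μ x := (cdf μ).rightLim_eq x
  have hm : (cdf μ).measure {x} = 0 := by rw [measure_cdf]; exact measure_singleton x
  rw [StieltjesFunction.measure_singleton, ENNReal.ofReal_eq_zero] at hm
  have hl : Function.leftLim (cdf μ) x = cdf μ x :=
    le_antisymm ((monotone_cdf μ).leftLim_le le_rfl) (by linarith)
  rw [(monotone_cdf μ).continuousAt_iff_leftLim_eq_rightLim, hl, hr]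

lemma cdf_level (μ : Measure ℝ) [IsProbabilityMeasure μ] [NullSingletonClass μ] {c : ℝ} (h0 : 0 < c)
    (h1 : c < 1) : μ {x | cdf μ x ≤ c} = ENNReal.ofReal c := by
  have hc := cdf_cont μ
  have hm := monotone_cdf μ
  obtain ⟨a, ha⟩ := ((tendsto_cdf_atBot μ).eventually (gt_mem_nhds h0)).exists
  obtain ⟨b, hb⟩ := ((tendsto_cdf_atTop μ).eventually (lt_mem_nhds h1)).exists
  obtain ⟨x0, hx0⟩ := mem_range_of_exists_le_of_exists_ge hc ⟨a, ha.le⟩ ⟨b, hb.le⟩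
  set A := {x | cdf μ x ≤ c} with hA
  have hcl : IsClosed A := isClosed_le hc continuous_const
  have hne : A.Nonempty := ⟨x0, hx0.le⟩
  have hbd : BddAbove A := ⟨b, fun x hx => by
    by_contra hlt
    push Not at hlt
    have := hm hlt.le
    have hx' : cdf μ x ≤ c := hx
    linarith⟩
  have hs : sSup A ∈ A := hcl.csSup_mem hne hbd
  have heq : A = Iic (sSup A) := by
    ext x
    refine ⟨fun hx => le_csSup hbd hx, fun hx => ?_⟩
    exact (hm hx).trans hs
  have hv : cdf μ (sSup A) = c :=
    le_antisymm hs (hx0 ▸ hm (le_csSup hbd hx0.le))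
  rw [heq, ← ofReal_cdf, hv]

lemma cdf_ae_pos (μ : Measure ℝ) [IsProbabilityMeasure μ] [NullSingletonClass μ] :
    μ {x | ¬ (0 < cdf μ x ∧ cdf μ x < 1)} = 0 := by
  have hsub : {x | ¬ (0 < cdf μ x ∧ cdf μ x < 1)} ⊆ {x | cdf μ x ≤ 0} ∪ {x | 1 ≤ cdf μ x} := by
    intro x hx
    by_contra hcon
    apply hx
    simp only [Set.mem_union, Set.mem_ofPred_eq, not_or, not_le] at hcon
    exact hcon
  refine measure_mono_null hsub (measure_union_null ?_ ?_)
  · refine le_antisymm (ENNReal.le_of_forall_pos_le_add fun ε hε _ => ?_) zero_le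
    set e : ℝ := min ε (1 / 2) with he
    have he0 : 0 < e := lt_min (by exact_mod_cast hε) (by norm_num)
    have he1 : e < 1 := lt_of_le_of_lt (min_le_right _ _) (by norm_num)
    calc μ {x | cdf μ x ≤ 0} ≤ μ {x | cdf μ x ≤ e} :=
          measure_mono fun x (hx : cdf μ x ≤ 0) => show cdf μ x ≤ e by linarith
      _ = ENNReal.ofReal e := cdf_level μ he0 he1
      _ ≤ ENNReal.ofReal (ε : ℝ) := ENNReal.ofReal_le_ofReal (min_le_left _ _)
      _ = 0 + ε := by simp
  · refine le_antisymm (ENNReal.le_of_forall_pos_le_add fun ε hε _ => ?_) zero_le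
    set e : ℝ := min ε (1 / 2) with he
    have he0 : 0 < e := lt_min (by exact_mod_cast hε) (by norm_num)
    have he1 : e < 1 := lt_of_le_of_lt (min_le_right _ _) (by norm_num)
    have hmeas : MeasurableSet {x | cdf μ x ≤ 1 - e} :=
      measurableSet_le (monotone_cdf μ).measurable measurable_const
    calc μ {x | 1 ≤ cdf μ x} ≤ μ {x | cdf μ x ≤ 1 - e}ᶜ :=
          measure_mono fun x (hx : 1 ≤ cdf μ x) => show ¬ (cdf μ x ≤ 1 - e) by linarith
      _ = 1 - ENNReal.ofReal (1 - e) := by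
          rw [prob_compl_eq_one_sub hmeas, cdf_level μ (by linarith) (by linarith)]
      _ = ENNReal.ofReal e := by
          rw [← ENNReal.ofReal_one, ← ENNReal.ofReal_sub _ (by linarith)]
          congr 1; ring
      _ ≤ ENNReal.ofReal (ε : ℝ) := ENNReal.ofReal_le_ofReal (min_le_left _ _)
      _ = 0 + ε := by simp

/-- Monotone transport between two atomless laws on the line, the second one with strictly
increasing distribution function. -/
lemma transport (μ γ : Measure ℝ) [IsProbabilityMeasure μ] [NullSingletonClass μ] [IsProbabilityMeasure γ]
    [NullSingletonClass γ] (hG : StrictMono (cdf γ)) :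
    ∃ T : ℝ → ℝ, Measurable T ∧ μ.map T = γ ∧
      ∀ x w, cdf γ (x - w) ≤ cdf μ x → cdf μ x ≤ cdf γ (x + w) → |T x - x| ≤ w := by
  classical
  have hc := cdf_cont γ
  have hpos : ∀ t, 0 < cdf γ t := fun t => (cdf_nonneg γ (t - 1)).trans_lt (hG (by linarith))
  have hlt : ∀ t, cdf γ t < 1 := fun t => (hG (by linarith : t < t + 1)).trans_le (cdf_le_one γ _)
  have hex : ∀ c : ℝ, 0 < c ∧ c < 1 → ∃ y, cdf γ y = c := by
    rintro c ⟨h0, h1⟩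
    obtain ⟨a, ha⟩ := ((tendsto_cdf_atBot γ).eventually (gt_mem_nhds h0)).exists
    obtain ⟨b, hb⟩ := ((tendsto_cdf_atTop γ).eventually (lt_mem_nhds h1)).exists
    exact mem_range_of_exists_le_of_exists_ge hc ⟨a, ha.le⟩ ⟨b, hb.le⟩
  set P : ℝ → Prop := fun x => 0 < cdf μ x ∧ cdf μ x < 1 with hP
  set T : ℝ → ℝ := fun x => if h : P x then (hex (cdf μ x) h).choose else 0 with hT
  have hTx : ∀ x, P x → cdf γ (T x) = cdf μ x := by
    intro x h
    simp only [hT, dif_pos h]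
    exact (hex (cdf μ x) h).choose_spec
  have hTn : ∀ x, ¬ P x → T x = 0 := by
    intro x h
    simp only [hT, dif_neg h]
  have hle : ∀ x t, P x → (T x ≤ t ↔ cdf μ x ≤ cdf γ t) := by
    intro x t h
    rw [← hTx x h, hG.le_iff_le]
  have hFm : Measurable (cdf μ) := (monotone_cdf μ).measurable
  have hPm : MeasurableSet {x | P x} :=
    (measurableSet_lt measurable_const hFm).inter (measurableSet_lt hFm measurable_const)
  have hTm : Measurable T := by
    apply measurable_of_Iic
    intro t
    have : T ⁻¹' Iic t = ({x | P x} ∩ {x | cdf μ x ≤ cdf γ t}) ∪ ({x | P x}ᶜ ∩ {_x | 0 ≤ t}) := by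
      ext x
      by_cases hx : P x
      · simp [hx, hle x t hx]
      · simp [hx, hTn x hx]
    rw [this]
    exact (hPm.inter (measurableSet_le hFm measurable_const)).union
      (hPm.compl.inter (MeasurableSet.const _))
  refine ⟨T, hTm, ?_, ?_⟩
  · have : IsProbabilityMeasure (μ.map T) := Measure.isProbabilityMeasure_map hTm.aemeasurable
    apply Measure.eq_of_cdf
    ext t
    have h1 : μ.map T (Iic t) = ENNReal.ofReal (cdf γ t) := by
      rw [Measure.map_apply hTm measurableSet_Iic, ← cdf_level μ (hpos t) (hlt t)]
      apply measure_congr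
      have hae : ∀ᵐ x ∂μ, P x := cdf_ae_pos μ
      filter_upwards [hae] with x hx
      exact propext (hle x t hx)
    rw [← ofReal_cdf] at h1
    exact (ENNReal.ofReal_eq_ofReal_iff (cdf_nonneg _ _) (cdf_nonneg _ _)).1 h1
  · intro x w h1 h2
    have hx : P x := ⟨(hpos _).trans_le h1, h2.trans_lt (hlt _)⟩
    rw [← hTx x hx, hG.le_iff_le] at h1 h2
    rw [abs_le]
    constructor <;> linarith


/-- The law with density `k`. -/
def kM (k : ℝ → ℝ) : Measure ℝ := volume.withDensity fun y => ENNReal.ofReal (k y)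

/-- The density of the convolution. -/
def fS (k : ℝ → ℝ) (F : Measure ℝ) (x : ℝ) : ℝ := ∫ y, k (x - y) ∂F

lemma IsKer.prob {C W : ℝ} {r : ℕ} {k : ℝ → ℝ} (H : IsKer C W r k) (hW : 1 ≤ W) :
    IsProbabilityMeasure (kM k) := by
  constructor
  rw [kM, withDensity_apply _ MeasurableSet.univ, Measure.restrict_univ,
    ← ofReal_integral_eq_lintegral_ofReal H.kint (ae_of_all _ H.nn), H.int1, ENNReal.ofReal_one]

lemma IsKer.lint {C W : ℝ} {r : ℕ} {k : ℝ → ℝ} (H : IsKer C W r k) (φ : ℝ → ℝ)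
    (hφ : Measurable φ) (hb : ∀ y, k y * φ y ≤ C * (1 + y ^ 2)⁻¹) :
    ∫⁻ y, ENNReal.ofReal (φ y) ∂(kM k) ≤ ENNReal.ofReal (C * π) := by
  have hk := H.cont
  rw [kM, lintegral_withDensity_eq_lintegral_mul _ (by fun_prop) (by fun_prop),
    ← integral_univ_inv_one_add_sq, ← integral_const_mul,
    ofReal_integral_eq_lintegral_ofReal (integrable_inv_one_add_sq.const_mul C)
      (ae_of_all _ fun y => ?_)]
  · apply lintegral_mono
    intro y
    simp only [Pi.mul_apply]
    rw [← ENNReal.ofReal_mul (H.nn y)]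
    exact ENNReal.ofReal_le_ofReal (hb y)
  · have := H.Cpos
    positivity

lemma IsKer.mom {C W : ℝ} {r : ℕ} {k : ℝ → ℝ} (H : IsKer C W r k) (hW : 1 ≤ W) {q : ℕ}
    (hq : q ≤ 2 * r) : ∫⁻ y, ENNReal.ofReal (|y| ^ q) ∂(kM k) ≤ ENNReal.ofReal (C * π) := by
  apply H.lint _ (by fun_prop)
  intro y
  refine le_trans ?_ (H.dec' y)
  have h0 := H.nn y
  have h1 : 1 ≤ exp (|y| / W) := one_le_exp (by positivity)
  have h2 : |y| ^ q ≤ 1 + |y| ^ (2 * r) := by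
    rcases le_total |y| 1 with h | h
    · have := pow_le_one₀ (n := q) (abs_nonneg y) h
      have : 0 ≤ |y| ^ (2 * r) := by positivity
      linarith
    · have := pow_le_pow_right₀ h hq
      linarith
  calc k y * |y| ^ q = k y * 1 * |y| ^ q := by ring
    _ ≤ _ := by gcongr

lemma IsKer.expmom {C W : ℝ} {r : ℕ} {k : ℝ → ℝ} (H : IsKer C W r k) (hW : 1 ≤ W) {s : ℝ}
    (hs : W ≤ s) : ∫⁻ y, ENNReal.ofReal (exp (|y| / s)) ∂(kM k) ≤ ENNReal.ofReal (C * π) := by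
  apply H.lint _ (by fun_prop)
  intro y
  refine le_trans ?_ (H.dec'' y)
  have h0 := H.nn y
  have : 0 < W := by linarith
  gcongr

lemma IsKer.bdd {C W : ℝ} {r : ℕ} {k : ℝ → ℝ} (H : IsKer C W r k) (hW : 1 ≤ W) (y : ℝ) :
    k y ≤ C := by
  have h0 := H.nn y
  have h1 : 1 ≤ exp (|y| / W) := one_le_exp (by positivity)
  calc k y = k y * 1 := by ring
    _ ≤ k y * exp (|y| / W) := by gcongr
    _ ≤ C * (1 + y ^ 2)⁻¹ := H.dec'' y
    _ ≤ C * 1 := by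
      have := H.Cpos
      gcongr
      exact inv_le_one_of_one_le₀ (by nlinarith)
    _ = C := by ring

lemma IsKer.fS_eq {C W : ℝ} {r : ℕ} {k : ℝ → ℝ} (H : IsKer C W r k) (hW : 1 ≤ W)
    (F : Measure ℝ) [IsProbabilityMeasure F] (x : ℝ) :
    ENNReal.ofReal (fS k F x) = ∫⁻ y, ENNReal.ofReal (k (x - y)) ∂F := by
  have hk := H.cont
  rw [fS, ofReal_integral_eq_lintegral_ofReal _ (ae_of_all _ fun y => H.nn _)]
  exact Integrable.of_bound (by fun_prop) C (ae_of_all _ fun y => by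
    rw [Real.norm_of_nonneg (H.nn _)]; exact H.bdd hW _)

lemma IsKer.law {C W : ℝ} {r : ℕ} {k : ℝ → ℝ} (H : IsKer C W r k) (hW : 1 ≤ W)
    (F : Measure ℝ) [IsProbabilityMeasure F] :
    (F.prod (kM k)).map (fun q => q.1 + q.2) =
      volume.withDensity fun x => ENNReal.ofReal (fS k F x) := by
  have hk := H.cont
  have hp := H.prob hW
  ext A hA
  rw [Measure.map_apply (by fun_prop) hA, withDensity_apply _ hA, Measure.prod_apply
    ((by fun_prop : Measurable fun q : ℝ × ℝ => q.1 + q.2) hA)]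
  simp_rw [H.fS_eq hW]
  have e1 : ∀ x : ℝ, kM k (Prod.mk x ⁻¹' ((fun q : ℝ × ℝ => q.1 + q.2) ⁻¹' A)) =
      ∫⁻ z, A.indicator (fun z => ENNReal.ofReal (k (z - x))) z := by
    intro x
    have hm : MeasurableSet (Prod.mk x ⁻¹' ((fun q : ℝ × ℝ => q.1 + q.2) ⁻¹' A)) :=
      measurable_prodMk_left ((by fun_prop : Measurable fun q : ℝ × ℝ => q.1 + q.2) hA)
    rw [kM, withDensity_apply _ hm, ← lintegral_indicator hm,
      ← lintegral_add_left_eq_self (A.indicator _) x]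
    congr 1
    ext z
    by_cases hz : x + z ∈ A
    · rw [indicator_of_mem (by exact hz), indicator_of_mem hz]; simp
    · rw [indicator_of_notMem (by exact hz), indicator_of_notMem hz]
  simp_rw [e1]
  rw [lintegral_lintegral_swap]
  · rw [← lintegral_indicator hA]
    congr 1
    ext z
    by_cases hz : z ∈ A
    · simp [hz]
    · simp [hz]
  · apply Measurable.aemeasurable
    have : (Function.uncurry fun (x z : ℝ) => A.indicator (fun z => ENNReal.ofReal (k (z - x))) z) =
      (Prod.snd ⁻¹' A).indicator (fun q : ℝ × ℝ => ENNReal.ofReal (k (q.2 - q.1))) := by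
      ext q; rfl
    rw [this]
    exact Measurable.indicator (by fun_prop) (measurable_snd hA)

lemma IsKer.fS_nonneg {C W : ℝ} {r : ℕ} {k : ℝ → ℝ} (H : IsKer C W r k)
    (F : Measure ℝ) (x : ℝ) : 0 ≤ fS k F x := integral_nonneg fun _ => H.nn _

lemma IsKer.fS_cont {C W : ℝ} {r : ℕ} {k : ℝ → ℝ} (H : IsKer C W r k) (hW : 1 ≤ W)
    (F : Measure ℝ) [IsProbabilityMeasure F] : Continuous (fS k F) := by
  have hk := H.cont
  unfold fS
  refine continuous_of_dominated (bound := fun _ => C) (fun x => by fun_prop)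
    (fun x => ae_of_all _ fun y => ?_) (integrable_const _) (ae_of_all _ fun y => by fun_prop)
  rw [Real.norm_of_nonneg (H.nn _)]; exact H.bdd hW _


lemma gs_pos {σ : ℝ} (hσ : 0 < σ) (x : ℝ) : 0 < gs σ x := by unfold gs; positivity

lemma gs_cont (σ : ℝ) : Continuous (gs σ) := by unfold gs; fun_prop

lemma gauss_dens {σ : ℝ} (hσ : 0 < σ) : gaussianReal 0 (σ ^ 2).toNNReal =
    volume.withDensity fun x => ENNReal.ofReal (gs σ x) := by
  have h0 : (σ ^ 2).toNNReal ≠ 0 := by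
    rw [ne_eq, Real.toNNReal_eq_zero, not_le]; positivity
  rw [gaussianReal_of_var_ne_zero _ h0]
  congr 1
  ext x
  rw [gaussianPDF, gaussianPDFReal_def, gs, Real.coe_toNNReal _ (by positivity)]
  congr 1
  beta_reduce
  rw [sub_zero, Real.sqrt_mul (by positivity), Real.sqrt_sq hσ.le, neg_div, mul_comm σ, inv_mul_eq_div]

/-- Comparison of two laws with densities on a measurable set. -/
lemma real_close (μ γ : Measure ℝ) [IsProbabilityMeasure μ] [IsProbabilityMeasure γ]
    (f g : ℝ → ℝ) (hf : Measurable f) (hg : Measurable g)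
    (hμ : μ = volume.withDensity fun x => ENNReal.ofReal (f x))
    (hγ : γ = volume.withDensity fun x => ENNReal.ofReal (g x))
    (A : Set ℝ) (hA : MeasurableSet A) (B : ℝ) (hB : 0 ≤ B)
    (h : ∫⁻ y in A, ENNReal.ofReal |f y - g y| ≤ ENNReal.ofReal B) :
    |μ.real A - γ.real A| ≤ B := by
  have key : ∀ (μ γ : Measure ℝ) [IsProbabilityMeasure μ] [IsProbabilityMeasure γ]
    (f g : ℝ → ℝ), Measurable f → Measurable g →
    μ = volume.withDensity (fun x => ENNReal.ofReal (f x)) →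
    γ = volume.withDensity (fun x => ENNReal.ofReal (g x)) →
    ∫⁻ y in A, ENNReal.ofReal |f y - g y| ≤ ENNReal.ofReal B →
    μ.real A ≤ γ.real A + B := by
    intro μ γ _ _ f g hf hg hμ hγ h
    have h1 : μ A ≤ γ A + ENNReal.ofReal B := by
      calc μ A = ∫⁻ y in A, ENNReal.ofReal (f y) := by rw [hμ, withDensity_apply _ hA]
        _ ≤ ∫⁻ y in A, (ENNReal.ofReal (g y) + ENNReal.ofReal |f y - g y|) := by
          apply lintegral_mono
          intro y
          refine le_trans (ENNReal.ofReal_le_ofReal ?_) ENNReal.ofReal_add_le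
          linarith [le_abs_self (f y - g y)]
        _ = γ A + ∫⁻ y in A, ENNReal.ofReal |f y - g y| := by
          rw [lintegral_add_left (by fun_prop), hγ, withDensity_apply _ hA]
        _ ≤ _ := by gcongr
    have h2 := ENNReal.toReal_mono (by finiteness) h1
    rwa [ENNReal.toReal_add (by finiteness) (by finiteness), ENNReal.toReal_ofReal hB] at h2
  have h1 := key μ γ f g hf hg hμ hγ h
  have h2 := key γ μ g f hg hf hγ hμ (by simpa only [abs_sub_comm] using h)
  rw [abs_le]
  constructor <;> linarith

lemma cdf_of_sets (μ γ : Measure ℝ) [IsProbabilityMeasure μ] [IsProbabilityMeasure γ] (x B : ℝ)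
    (h : ∀ A : Set ℝ, MeasurableSet A → (∀ y ∈ A, 0 ≤ x * (y - x)) →
      |μ.real A - γ.real A| ≤ B) : |cdf μ x - cdf γ x| ≤ B := by
  rw [cdf_eq_real, cdf_eq_real]
  rcases le_total 0 x with hx | hx
  · have := h (Ioi x) measurableSet_Ioi fun y (hy : x < y) => mul_nonneg hx (by linarith)
    rw [← compl_Iic, probReal_compl_eq_one_sub measurableSet_Iic,
      probReal_compl_eq_one_sub measurableSet_Iic, abs_sub_comm] at this
    convert this using 2
    ring
  · exact h (Iic x) measurableSet_Iic fun y (hy : y ≤ x) =>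
      mul_nonneg_of_nonpos_of_nonpos hx (by linarith)

lemma tail_one {σ : ℝ} (hσ : 0 < σ) (x y : ℝ) (h : 0 ≤ x * (y - x)) :
    (1 + |y / σ| ^ 3) * gs σ y ≤ 8 * (1 + |x / σ| ^ 3) * gs σ x *
      ((1 + |(y - x) / σ| ^ 3) * exp (-(1 / 2) * ((y - x) / σ) ^ 2)) := by
  have h1 : gs σ y ≤ gs σ x * exp (-(1 / 2) * ((y - x) / σ) ^ 2) := by
    unfold gs
    rw [div_mul_eq_mul_div, ← exp_add]
    gcongr
    have : -(y ^ 2 / (2 * σ ^ 2)) = -(x ^ 2 / (2 * σ ^ 2)) + -(1 / 2) * ((y - x) / σ) ^ 2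
      - x * (y - x) / σ ^ 2 := by field_simp; ring
    rw [this]
    have : 0 ≤ x * (y - x) / σ ^ 2 := by positivity
    linarith
  have h2 : 1 + |y / σ| ^ 3 ≤ 8 * ((1 + |x / σ| ^ 3) * (1 + |(y - x) / σ| ^ 3)) := by
    have hle : |y / σ| ≤ |x / σ| + |(y - x) / σ| := by
      refine le_trans (le_of_eq ?_) (abs_add_le _ _)
      congr 1; ring
    have key : ∀ a b c : ℝ, 0 ≤ a → 0 ≤ b → 0 ≤ c → c ≤ a + b →
        1 + c ^ 3 ≤ 8 * ((1 + a ^ 3) * (1 + b ^ 3)) := by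
      intro a b c ha hb hc0 hcab
      have hc : c ^ 3 ≤ (a + b) ^ 3 := by gcongr
      have : (a + b) ^ 3 ≤ 4 * (a ^ 3 + b ^ 3) := by
        nlinarith [mul_nonneg (add_nonneg ha hb) (sq_nonneg (a - b))]
      have : 0 ≤ a ^ 3 * b ^ 3 := by positivity
      have : 0 ≤ a ^ 3 := by positivity
      have : 0 ≤ b ^ 3 := by positivity
      nlinarith
    exact key _ _ _ (abs_nonneg _) (abs_nonneg _) (abs_nonneg _) hle
  have := gs_pos hσ x
  have := gs_pos hσ y
  calc (1 + |y / σ| ^ 3) * gs σ y ≤ 8 * ((1 + |x / σ| ^ 3) * (1 + |(y - x) / σ| ^ 3)) *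
      (gs σ x * exp (-(1 / 2) * ((y - x) / σ) ^ 2)) := by gcongr
    _ = _ := by ring

lemma tail_int {σ : ℝ} (hσ : 0 < σ) (x : ℝ) :
    ∫⁻ y, ENNReal.ofReal ((1 + |(y - x) / σ| ^ 3) * exp (-(1 / 2) * ((y - x) / σ) ^ 2)) =
      ENNReal.ofReal (σ * ∫ s, (1 + |s| ^ 3) * exp (-(1 / 2) * s ^ 2)) := by
  have hi := cube_gauss_int (b := 1 / 2) (by norm_num)
  have h1 : Integrable fun y : ℝ => (1 + |(y - x) / σ| ^ 3) * exp (-(1 / 2) * ((y - x) / σ) ^ 2) :=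
    (hi.comp_div hσ.ne').comp_sub_right x
  rw [← ofReal_integral_eq_lintegral_ofReal h1 (ae_of_all _ fun y => by positivity)]
  congr 1
  rw [integral_sub_right_eq_self
    (fun y : ℝ => (1 + |y / σ| ^ 3) * exp (-(1 / 2) * (y / σ) ^ 2)) x,
    Measure.integral_comp_div (fun s : ℝ => (1 + |s| ^ 3) * exp (-(1 / 2) * s ^ 2)),
    abs_of_pos hσ, smul_eq_mul]

lemma lint_dens (μ : Measure ℝ) (f φ : ℝ → ℝ) (hf : Measurable f) (hf0 : ∀ y, 0 ≤ f y)
    (hφ : Measurable φ) (hμ : μ = volume.withDensity fun x => ENNReal.ofReal (f x)) :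
    ∫⁻ y, ENNReal.ofReal (φ y) ∂μ = ∫⁻ y, ENNReal.ofReal (φ y * f y) := by
  rw [hμ, lintegral_withDensity_eq_lintegral_mul _ (by fun_prop) (by fun_prop)]
  congr 1
  ext y
  simp only [Pi.mul_apply]
  rw [← ENNReal.ofReal_mul (hf0 y), mul_comm]


lemma pw_bound {C L D : ℝ} {r : ℕ} {k : ℝ → ℝ} (H : IsKer C (L ^ 2) r k) (hL : 2 ≤ L) {σ : ℝ}
    (hσ : σ = L ^ 3) (hD : 0 ≤ D) (F : Measure ℝ)
    (hl : ∀ x, |x| ≤ σ * L → |fS k F x - gs σ x| ≤ D / σ * (1 + |x / σ| ^ 3) * gs σ x) (y : ℝ) :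
    |fS k F y - gs σ y| ≤ D / σ * ((1 + |y / σ| ^ 3) * gs σ y) +
      exp (-L) * (exp (|y| / σ) * fS k F y + exp (|y| / σ) * gs σ y) := by
  have hσ0 : 0 < σ := by rw [hσ]; positivity
  have hg := gs_pos hσ0 y
  have hf := H.fS_nonneg F y
  rcases le_total |y| (σ * L) with h | h
  · refine (hl y h).trans ?_
    rw [mul_assoc]
    exact le_add_of_nonneg_right (by positivity)
  · have h1 : 1 ≤ exp (-L) * exp (|y| / σ) := by
      rw [← exp_add]
      apply one_le_exp
      have : L ≤ |y| / σ := by rw [le_div_iff₀ hσ0]; linarith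
      linarith
    have h2 : |fS k F y - gs σ y| ≤ fS k F y + gs σ y := by
      rw [abs_le]; constructor <;> linarith
    have h3 : 0 ≤ D / σ * ((1 + |y / σ| ^ 3) * gs σ y) := by positivity
    nlinarith [mul_le_mul_of_nonneg_right h1 (add_nonneg hf hg.le)]

lemma exp_small {L : ℝ} (hL : 2 ≤ L) {σ x : ℝ} (hσ : σ = L ^ 3) (hx : (x / σ) ^ 2 ≤ L) :
    exp (-L) ≤ 144 * gs σ x := by
  have hσ0 : 0 < σ := by rw [hσ]; positivity
  have h1 : L ^ 3 ≤ 48 * exp (L / 2) := by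
    have := Real.pow_div_factorial_le_exp (L / 2) (by linarith) 3
    norm_num [Nat.factorial] at this
    nlinarith
  have h2 : √(2 * π) ≤ 3 := by
    rw [Real.sqrt_le_left (by norm_num)]
    nlinarith [Real.pi_lt_four]
  have h3 : exp (-(L / 2)) ≤ exp (-(x ^ 2 / (2 * σ ^ 2))) := by
    apply exp_le_exp.2
    rw [div_pow] at hx
    have : x ^ 2 / (2 * σ ^ 2) = x ^ 2 / σ ^ 2 / 2 := by field_simp
    rw [this]; linarith
  unfold gs
  rw [mul_div_assoc', le_div_iff₀ (by positivity)]
  calc exp (-L) * (σ * √(2 * π)) ≤ exp (-L) * ((48 * exp (L / 2)) * 3) := by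
        rw [hσ]; gcongr
    _ = 144 * (exp (-L) * exp (L / 2)) := by ring
    _ = 144 * exp (-(L / 2)) := by rw [← exp_add]; congr 2; ring
    _ ≤ _ := by gcongr

lemma cdf_close (C : ℝ) (hC : 0 ≤ C) : ∃ D' : ℝ, 0 < D' ∧ ∀ (L : ℝ) (r : ℕ) (k : ℝ → ℝ),
    IsKer C (L ^ 2) r k → 1 ≤ r → 2 ≤ L → ∀ σ, σ = L ^ 3 → ∀ F : Measure ℝ,
    IsProbabilityMeasure F → CoreA F (σ ^ 2) 1 → ∀ x, (x / σ) ^ 2 ≤ L →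
    |cdf ((F.prod (kM k)).map (fun q => q.1 + q.2)) x - cdf (gaussianReal 0 (σ ^ 2).toNNReal) x|
      ≤ D' * (1 + |x / σ| ^ 3) * gs σ x := by
  obtain ⟨D, hD, hlim⟩ := local_limit C
  set M3 : ℝ := ∫ s, (1 + |s| ^ 3) * exp (-(1 / 2) * s ^ 2) with hM3
  have hM0 : 0 ≤ M3 := integral_nonneg fun s => by positivity
  set Me : ℝ := C * π * (2 * exp (3 / 2)) + 2 * exp (3 / 2) with hMe
  have hMe0 : 0 < Me := by positivity
  refine ⟨8 * D * M3 + 144 * Me, by positivity, ?_⟩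
  intro L r k H hr hL σ hσ F hF hcore x hx
  have hσ0 : 0 < σ := by rw [hσ]; positivity
  have hσ1 : 1 < σ := by rw [hσ]; nlinarith [pow_le_pow_left₀ (by norm_num) hL 3]
  have hW : 1 ≤ L ^ 2 := by nlinarith
  have hWσ : L ^ 2 ≤ σ := by rw [hσ]; nlinarith
  have hK := H.prob hW
  have hl : ∀ x, |x| ≤ σ * L → |fS k F x - gs σ x| ≤ D / σ * (1 + |x / σ| ^ 3) * gs σ x :=
    fun x hx => hlim L r k H hr hL σ hσ F hF hcore x hx
  have hlaw := H.law hW F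
  have hga := gauss_dens hσ0
  set ν := (F.prod (kM k)).map (fun q => q.1 + q.2) with hν
  have hνp : IsProbabilityMeasure ν := Measure.isProbabilityMeasure_map (by fun_prop)
  set γ := gaussianReal 0 (σ ^ 2).toNNReal with hγ
  have hfc := H.fS_cont hW F
  have hgc := gs_cont σ
  have hfm : Measurable (fS k F) := hfc.measurable
  have hgm : Measurable (gs σ) := hgc.measurable
  have hf0 := H.fS_nonneg F
  have hg0 := gs_pos hσ0
  have hexpo : σ ^ 2 / σ ^ 2 / 2 + σ ^ 2 / σ ^ 3 ≤ 3 / 2 := by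
    have : σ ^ 2 / σ ^ 3 ≤ 1 := by rw [div_le_one (by positivity)]; gcongr <;> linarith
    rw [div_self (by positivity)]; linarith
  have hmg : ∫⁻ y, ENNReal.ofReal (exp (|y| / σ)) ∂γ ≤ ENNReal.ofReal (2 * exp (3 / 2)) := by
    refine (core_expabs (core_gauss (by positivity)) hσ1).trans (ENNReal.ofReal_le_ofReal ?_)
    gcongr
  have hmF : ∫⁻ y, ENNReal.ofReal (exp (|y| / σ)) ∂F ≤ ENNReal.ofReal (2 * exp (3 / 2)) := by
    refine (core_expabs hcore hσ1).trans (ENNReal.ofReal_le_ofReal ?_)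
    gcongr
  have hmν : ∫⁻ y, ENNReal.ofReal (exp (|y| / σ)) ∂ν ≤
      ENNReal.ofReal (C * π * (2 * exp (3 / 2))) := by
    rw [hν, lintegral_map (by fun_prop) (by fun_prop)]
    calc ∫⁻ q : ℝ × ℝ, ENNReal.ofReal (exp (|q.1 + q.2| / σ)) ∂(F.prod (kM k))
        ≤ ∫⁻ q : ℝ × ℝ, ENNReal.ofReal (exp (|q.1| / σ)) * ENNReal.ofReal (exp (|q.2| / σ))
            ∂(F.prod (kM k)) := by
          apply lintegral_mono
          intro q
          dsimp only
          rw [← ENNReal.ofReal_mul (exp_pos _).le, ← exp_add, ← add_div]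
          apply ENNReal.ofReal_le_ofReal
          gcongr
          exact abs_add_le _ _
      _ = _ := lintegral_prod_mul
          (f := fun y : ℝ => ENNReal.ofReal (exp (|y| / σ)))
          (g := fun y : ℝ => ENNReal.ofReal (exp (|y| / σ))) (by fun_prop) (by fun_prop)
      _ ≤ ENNReal.ofReal (2 * exp (3 / 2)) * ENNReal.ofReal (C * π) :=
          mul_le_mul' hmF (H.expmom hW hWσ)
      _ = _ := by rw [← ENNReal.ofReal_mul (by positivity)]; congr 1; ring
  set B : ℝ := D / σ * (8 * (1 + |x / σ| ^ 3) * gs σ x) * (σ * M3) + exp (-L) * Me with hB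
  have hgx := hg0 x
  have hBle : B ≤ (8 * D * M3 + 144 * Me) * (1 + |x / σ| ^ 3) * gs σ x := by
    have h1 := exp_small hL hσ hx
    have h2 : D / σ * (8 * (1 + |x / σ| ^ 3) * gs σ x) * (σ * M3) =
      8 * D * M3 * (1 + |x / σ| ^ 3) * gs σ x := by field_simp
    have h3 : exp (-L) * Me ≤ 144 * Me * (1 + |x / σ| ^ 3) * gs σ x := by
      calc exp (-L) * Me ≤ 144 * gs σ x * Me := by gcongr
        _ = 144 * Me * 1 * gs σ x := by ring
        _ ≤ _ := by
          have : 1 ≤ 1 + |x / σ| ^ 3 := by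
            have : 0 ≤ |x / σ| ^ 3 := by positivity
            linarith
          gcongr
    rw [hB, h2]; linarith
  refine le_trans ?_ hBle
  apply cdf_of_sets
  intro A hA hxA
  refine real_close ν γ (fS k F) (gs σ) hfm hgm hlaw hga A hA B (by positivity) ?_
  calc ∫⁻ y in A, ENNReal.ofReal |fS k F y - gs σ y|
      ≤ ∫⁻ y in A, (ENNReal.ofReal (D / σ * (8 * (1 + |x / σ| ^ 3) * gs σ x)) *
          ENNReal.ofReal ((1 + |(y - x) / σ| ^ 3) * exp (-(1 / 2) * ((y - x) / σ) ^ 2)) +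
          ENNReal.ofReal (exp (-L)) * (ENNReal.ofReal (exp (|y| / σ) * fS k F y) +
            ENNReal.ofReal (exp (|y| / σ) * gs σ y))) := by
        apply setLIntegral_mono' hA
        intro y hy
        have hfy := hf0 y
        have hgy := hg0 y
        rw [← ENNReal.ofReal_add (by positivity) (by positivity),
          ← ENNReal.ofReal_mul (by positivity), ← ENNReal.ofReal_mul (by positivity),
          ← ENNReal.ofReal_add (by positivity) (by positivity)]
        apply ENNReal.ofReal_le_ofReal
        refine (pw_bound H hL hσ hD F hl y).trans ?_
        have := tail_one hσ0 x y (hxA y hy)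
        rw [mul_assoc (D / σ)]
        gcongr
    _ ≤ ∫⁻ y, (ENNReal.ofReal (D / σ * (8 * (1 + |x / σ| ^ 3) * gs σ x)) *
          ENNReal.ofReal ((1 + |(y - x) / σ| ^ 3) * exp (-(1 / 2) * ((y - x) / σ) ^ 2)) +
          ENNReal.ofReal (exp (-L)) * (ENNReal.ofReal (exp (|y| / σ) * fS k F y) +
            ENNReal.ofReal (exp (|y| / σ) * gs σ y))) := setLIntegral_le_lintegral _ _
    _ = ENNReal.ofReal (D / σ * (8 * (1 + |x / σ| ^ 3) * gs σ x)) * ENNReal.ofReal (σ * M3) +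
          ENNReal.ofReal (exp (-L)) * (∫⁻ y, ENNReal.ofReal (exp (|y| / σ)) ∂ν +
            ∫⁻ y, ENNReal.ofReal (exp (|y| / σ)) ∂γ) := by
        rw [lintegral_add_left (by fun_prop), lintegral_const_mul _ (by fun_prop), tail_int hσ0 x,
          lintegral_const_mul _ (by fun_prop), lintegral_add_left (by fun_prop),
          lint_dens ν (fS k F) _ hfm hf0 (by fun_prop) hlaw,
          lint_dens γ (gs σ) _ hgm (fun y => (hg0 y).le) (by fun_prop) hga]
    _ ≤ ENNReal.ofReal (D / σ * (8 * (1 + |x / σ| ^ 3) * gs σ x)) * ENNReal.ofReal (σ * M3) +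
          ENNReal.ofReal (exp (-L)) * (ENNReal.ofReal (C * π * (2 * exp (3 / 2))) +
            ENNReal.ofReal (2 * exp (3 / 2))) := by gcongr
    _ = ENNReal.ofReal B := by
        rw [← ENNReal.ofReal_add (by positivity) (by positivity),
          ← ENNReal.ofReal_mul (by positivity), ← ENNReal.ofReal_mul (by positivity),
          ← ENNReal.ofReal_add (by positivity) (by positivity)]


lemma gauss_null {σ : ℝ} (hσ : 0 < σ) :
    NullSingletonClass (gaussianReal 0 (σ ^ 2).toNNReal) := by
  rw [gauss_dens hσ]; infer_instance

lemma cdf_gap {σ : ℝ} (hσ : 0 < σ) {a b m : ℝ} (hab : a ≤ b) (hm : 0 ≤ m)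
    (h : ∀ y, a ≤ y → y ≤ b → m ≤ gs σ y) :
    m * (b - a) ≤ cdf (gaussianReal 0 (σ ^ 2).toNNReal) b -
      cdf (gaussianReal 0 (σ ^ 2).toNNReal) a := by
  set γ := gaussianReal 0 (σ ^ 2).toNNReal with hγ
  have h1 : ENNReal.ofReal (m * (b - a)) ≤ ENNReal.ofReal (cdf γ b - cdf γ a) := by
    rw [← StieltjesFunction.measure_Ioc, measure_cdf, hγ, gauss_dens hσ,
      withDensity_apply _ measurableSet_Ioc, ENNReal.ofReal_mul hm, ← Real.volume_Ioc,
      ← setLIntegral_const]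
    apply setLIntegral_mono' measurableSet_Ioc
    intro y hy
    exact ENNReal.ofReal_le_ofReal (h y hy.1.le hy.2)
  exact (ENNReal.ofReal_le_ofReal_iff (sub_nonneg.2 (monotone_cdf γ hab))).1 h1

lemma gs_anti {σ : ℝ} (hσ : 0 < σ) {x y : ℝ} (h : x ^ 2 ≤ y ^ 2) : gs σ y ≤ gs σ x := by
  unfold gs; gcongr

lemma gauss_strict {σ : ℝ} (hσ : 0 < σ) : StrictMono (cdf (gaussianReal 0 (σ ^ 2).toNNReal)) := by
  intro a b hab
  have h0 := gs_pos hσ (|a| + |b|)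
  have := cdf_gap hσ hab.le h0.le fun y h1 h2 => gs_anti hσ (by
    apply sq_le_sq'
    · linarith [neg_abs_le a, abs_nonneg b]
    · linarith [le_abs_self b, abs_nonneg a])
  have : 0 < gs σ (|a| + |b|) * (b - a) := mul_pos h0 (by linarith)
  linarith

lemma gs_shift {L σ x y C' : ℝ} (hL : 2 ≤ L) (hσ : σ = L ^ 3) (hC : 0 < C') (hCL : 4 * C' ≤ L)
    (hx : (x / σ) ^ 2 ≤ L) (hy : |y - x| ≤ C' * (1 + |x / σ| ^ 3)) :
    exp (-1) * gs σ x ≤ gs σ y := by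
  have hL0 : 0 < L := by linarith
  have hσ0 : 0 < σ := by rw [hσ]; positivity
  set a := |x / σ| with ha
  set b := |(y - x) / σ| with hb
  have ha0 : 0 ≤ a := abs_nonneg _
  have hb0 : 0 ≤ b := abs_nonneg _
  have ha2 : a ^ 2 ≤ L := by rw [ha, sq_abs]; exact hx
  have hbL : b * L ^ 3 ≤ C' * (1 + a ^ 3) := by
    rw [hb, abs_div, abs_of_pos hσ0, ← hσ, div_mul_cancel₀ _ hσ0.ne']
    exact hy
  have haL : a ≤ L := by nlinarith [sq_nonneg (a - 1)]
  have h3 : 1 + a ^ 3 ≤ 2 * L ^ 2 := by nlinarith [mul_nonneg ha0 (sub_nonneg.2 ha2)]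
  have h4 : a * (1 + a ^ 3) ≤ 2 * L ^ 2 := by
    nlinarith [mul_nonneg (sq_nonneg a) (sub_nonneg.2 ha2)]
  have hb1 : b ≤ 1 / 2 := by
    have : b * L ^ 3 ≤ (1 / 2) * L ^ 3 := by
      calc b * L ^ 3 ≤ C' * (1 + a ^ 3) := hbL
        _ ≤ (L / 4) * (2 * L ^ 2) := by gcongr; linarith
        _ = _ := by ring
    exact le_of_mul_le_mul_right this (by positivity)
  have hab : a * b ≤ 1 / 2 := by
    have : a * b * L ^ 3 ≤ (1 / 2) * L ^ 3 := by
      calc a * b * L ^ 3 = a * (b * L ^ 3) := by ring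
        _ ≤ a * (C' * (1 + a ^ 3)) := by gcongr
        _ = C' * (a * (1 + a ^ 3)) := by ring
        _ ≤ (L / 4) * (2 * L ^ 2) := by gcongr; linarith
        _ = _ := by ring
    exact le_of_mul_le_mul_right this (by positivity)
  unfold gs
  rw [mul_div_assoc', ← exp_add]
  gcongr
  have e : -(y ^ 2 / (2 * σ ^ 2)) = -(x ^ 2 / (2 * σ ^ 2)) - (x / σ) * ((y - x) / σ)
      - ((y - x) / σ) ^ 2 / 2 := by field_simp; ring
  have h5 : (x / σ) * ((y - x) / σ) ≤ a * b := by
    rw [ha, hb, ← abs_mul]; exact le_abs_self _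
  have h6 : ((y - x) / σ) ^ 2 = b ^ 2 := by rw [hb, sq_abs]
  rw [e, h6]
  nlinarith

lemma transport_close (C : ℝ) (hC : 0 ≤ C) : ∃ C' : ℝ, 0 < C' ∧ ∀ (L : ℝ) (r : ℕ) (k : ℝ → ℝ),
    IsKer C (L ^ 2) r k → 1 ≤ r → 2 ≤ L → 4 * C' ≤ L → ∀ σ, σ = L ^ 3 → ∀ F : Measure ℝ,
    IsProbabilityMeasure F → CoreA F (σ ^ 2) 1 →
    ∃ T : ℝ → ℝ, Measurable T ∧ ((F.prod (kM k)).map (fun q => q.1 + q.2)).map T =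
      gaussianReal 0 (σ ^ 2).toNNReal ∧
      ∀ x, (x / σ) ^ 2 ≤ L → |T x - x| ≤ C' * (1 + |x / σ| ^ 3) := by
  obtain ⟨D', hD', hclose⟩ := cdf_close C hC
  refine ⟨exp 1 * D', by positivity, ?_⟩
  intro L r k H hr hL hCL σ hσ F hF hcore
  have hL0 : 0 < L := by linarith
  have hσ0 : 0 < σ := by rw [hσ]; positivity
  have hW : 1 ≤ L ^ 2 := by nlinarith
  have hK := H.prob hW
  have hcl := hclose L r k H hr hL σ hσ F hF hcore
  have hlaw := H.law hW F
  set ν := (F.prod (kM k)).map (fun q => q.1 + q.2) with hν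
  have hνp : IsProbabilityMeasure ν := Measure.isProbabilityMeasure_map (by fun_prop)
  have hνn : NullSingletonClass ν := by rw [hlaw]; infer_instance
  have hγn := gauss_null hσ0
  obtain ⟨T, hT, hTl, hTc⟩ := transport ν (gaussianReal 0 (σ ^ 2).toNNReal) (gauss_strict hσ0)
  refine ⟨T, hT, hTl, fun x hx => ?_⟩
  have h0 := hcl x hx
  set w := exp 1 * D' * (1 + |x / σ| ^ 3) with hw
  have hw0 : 0 ≤ w := by positivity
  have hg := gs_pos hσ0 x
  have hC0 : 0 < exp 1 * D' := by positivity
  have hgap : ∀ y, |y - x| ≤ w → exp (-1) * gs σ x ≤ gs σ y := fun y hy =>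
    gs_shift hL hσ hC0 hCL hx hy
  have hval : exp (-1) * gs σ x * w = D' * (1 + |x / σ| ^ 3) * gs σ x := by
    rw [hw]
    calc _ = (exp (-1) * exp 1) * (D' * (1 + |x / σ| ^ 3) * gs σ x) := by ring
      _ = _ := by rw [← exp_add]; simp
  have g1 := cdf_gap hσ0 (a := x) (b := x + w) (m := exp (-1) * gs σ x) (by linarith)
    (by positivity) fun y h1 h2 => hgap y (by rw [abs_le]; constructor <;> linarith)
  have g2 := cdf_gap hσ0 (a := x - w) (b := x) (m := exp (-1) * gs σ x) (by linarith)
    (by positivity) fun y h1 h2 => hgap y (by rw [abs_le]; constructor <;> linarith)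
  rw [show x + w - x = w by ring, hval] at g1
  rw [show x - (x - w) = w by ring, hval] at g2
  rw [abs_le] at h0
  exact hTc x w (by linarith) (by linarith)


/-- A measurable function whose (extended) expectation is at most `c`. -/
def Bd {Ω : Type} [MeasurableSpace Ω] (P : Measure Ω) (X : Ω → ℝ) (c : ℝ) : Prop :=
  Measurable X ∧ 0 ≤ c ∧ ∫⁻ q, ENNReal.ofReal (X q) ∂P ≤ ENNReal.ofReal c

lemma Bd.add {Ω : Type} [MeasurableSpace Ω] {P : Measure Ω} {X Y : Ω → ℝ} {c d : ℝ}
    (h1 : Bd P X c) (h2 : Bd P Y d) : Bd P (fun q => X q + Y q) (c + d) := by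
  have hX := h1.1
  refine ⟨h1.1.add h2.1, add_nonneg h1.2.1 h2.2.1, ?_⟩
  calc ∫⁻ q, ENNReal.ofReal (X q + Y q) ∂P
      ≤ ∫⁻ q, (ENNReal.ofReal (X q) + ENNReal.ofReal (Y q)) ∂P :=
        lintegral_mono fun q => ENNReal.ofReal_add_le
    _ = _ := lintegral_add_left (by fun_prop) _
    _ ≤ _ := add_le_add h1.2.2 h2.2.2
    _ = _ := by rw [ENNReal.ofReal_add h1.2.1 h2.2.1]

lemma Bd.cmul {Ω : Type} [MeasurableSpace Ω] {P : Measure Ω} {X : Ω → ℝ} {c : ℝ}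
    (h1 : Bd P X c) {a : ℝ} (ha : 0 ≤ a) : Bd P (fun q => a * X q) (a * c) := by
  have hX := h1.1
  refine ⟨h1.1.const_mul a, mul_nonneg ha h1.2.1, ?_⟩
  simp_rw [ENNReal.ofReal_mul ha]
  rw [lintegral_const_mul _ (by fun_prop)]
  gcongr
  exact h1.2.2

lemma Bd.mono {Ω : Type} [MeasurableSpace Ω] {P : Measure Ω} {X Y : Ω → ℝ} {c : ℝ}
    (h1 : Bd P Y c) (hX : Measurable X) (h : ∀ q, X q ≤ Y q) : Bd P X c :=
  ⟨hX, h1.2.1, (lintegral_mono fun q => ENNReal.ofReal_le_ofReal (h q)).trans h1.2.2⟩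

lemma Bd.le {Ω : Type} [MeasurableSpace Ω] {P : Measure Ω} {X : Ω → ℝ} {c d : ℝ}
    (h1 : Bd P X c) (h : c ≤ d) : Bd P X d :=
  ⟨h1.1, h1.2.1.trans h, h1.2.2.trans (ENNReal.ofReal_le_ofReal h)⟩

lemma Bd.one {Ω : Type} [MeasurableSpace Ω] {P : Measure Ω} [IsProbabilityMeasure P] :
    Bd P (fun _ => (1 : ℝ)) 1 := ⟨measurable_const, zero_le_one, by simp⟩

lemma Bd.comp {Ω : Type} [MeasurableSpace Ω] {P : Measure Ω} {X : ℝ → ℝ} {c : ℝ} {f : Ω → ℝ}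
    (hf : Measurable f) (h : Bd (P.map f) X c) : Bd P (fun q => X (f q)) c := by
  have hX := h.1
  refine ⟨h.1.comp hf, h.2.1, ?_⟩
  have := h.2.2
  rwa [lintegral_map (by fun_prop) hf] at this

lemma add_pow_le_two (n : ℕ) {a b : ℝ} (ha : 0 ≤ a) (hb : 0 ≤ b) :
    (a + b) ^ n ≤ 2 ^ n * (a ^ n + b ^ n) := by
  have h1 : a + b ≤ 2 * max a b := by linarith [le_max_left a b, le_max_right a b]
  have h2 : (max a b) ^ n ≤ a ^ n + b ^ n := by
    have : 0 ≤ a ^ n := by positivity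
    have : 0 ≤ b ^ n := by positivity
    rcases max_choice a b with h | h <;> rw [h] <;> linarith
  calc (a + b) ^ n ≤ (2 * max a b) ^ n := by gcongr
    _ = 2 ^ n * (max a b) ^ n := mul_pow _ _ _
    _ ≤ _ := by gcongr

lemma abs_sub_pow (n : ℕ) (a b : ℝ) : |a - b| ^ n ≤ 2 ^ n * (|a| ^ n + |b| ^ n) :=
  (pow_le_pow_left₀ (abs_nonneg _) (abs_sub a b) n).trans
    (add_pow_le_two n (abs_nonneg a) (abs_nonneg b))

lemma abs_add_pow (n : ℕ) (a b : ℝ) : |a + b| ^ n ≤ 2 ^ n * (|a| ^ n + |b| ^ n) :=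
  (pow_le_pow_left₀ (abs_nonneg _) (abs_add_le a b) n).trans
    (add_pow_le_two n (abs_nonneg a) (abs_nonneg b))

lemma cost_pw (n : ℕ) {L σ C' x y T : ℝ} (hL : 2 ≤ L) (hσ : σ = L ^ 3) (hC : 0 < C')
    (hT : ((x + y) / σ) ^ 2 ≤ L → |T - (x + y)| ≤ C' * (1 + |(x + y) / σ| ^ 3)) :
    |x - T| ^ n ≤ 2 ^ n * (|y| ^ n + (C' ^ n * (2 ^ n * (1 + |(x + y) / σ| ^ (3 * n))) +
      2 ^ (2 * n) * (|(x + y) / σ| ^ (2 * n) + |T / σ| ^ (2 * n)) +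
      |(x + y) / σ| ^ (12 * n))) := by
  have hσ0 : 0 < σ := by rw [hσ]; positivity
  have h1 : |x - T| ^ n ≤ 2 ^ n * (|y| ^ n + |T - (x + y)| ^ n) := by
    have : |x - T| ≤ |y| + |T - (x + y)| := by
      calc |x - T| = |(-y) - (T - (x + y))| := by congr 1; ring
        _ ≤ _ := (abs_sub _ _).trans (by rw [abs_neg])
    exact (pow_le_pow_left₀ (abs_nonneg _) this n).trans
      (add_pow_le_two n (abs_nonneg _) (abs_nonneg _))
  refine h1.trans ?_
  gcongr
  set S := x + y with hS
  have p1 : 0 ≤ C' ^ n * (2 ^ n * (1 + |S / σ| ^ (3 * n))) := by positivity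
  have p2 : 0 ≤ 2 ^ (2 * n) * (|S / σ| ^ (2 * n) + |T / σ| ^ (2 * n)) := by positivity
  have p3 : 0 ≤ |S / σ| ^ (12 * n) := by positivity
  by_cases hx : (S / σ) ^ 2 ≤ L
  · have h2 : |T - S| ^ n ≤ C' ^ n * (2 ^ n * (1 + |S / σ| ^ (3 * n))) := by
      calc |T - S| ^ n ≤ (C' * (1 + |S / σ| ^ 3)) ^ n := by gcongr; exact hT hx
        _ = C' ^ n * (1 + |S / σ| ^ 3) ^ n := mul_pow _ _ _
        _ ≤ C' ^ n * (2 ^ n * (1 ^ n + (|S / σ| ^ 3) ^ n)) := by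
          gcongr
          exact add_pow_le_two n zero_le_one (by positivity)
        _ = _ := by rw [one_pow, pow_mul]
    linarith
  · push Not at hx
    have h2 : |T - S| ^ n = σ ^ n * |S / σ - T / σ| ^ n := by
      rw [← sub_div, abs_div, abs_of_pos hσ0, ← mul_pow, mul_div_cancel₀ _ hσ0.ne', abs_sub_comm]
    have h3 : σ ^ n * |S / σ - T / σ| ^ n ≤ σ ^ (2 * n) + |S / σ - T / σ| ^ (2 * n) := by
      rw [mul_comm 2 n, pow_mul, pow_mul]
      have : 0 ≤ σ ^ n := by positivity
      have : 0 ≤ |S / σ - T / σ| ^ n := by positivity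
      nlinarith [sq_nonneg (σ ^ n - |S / σ - T / σ| ^ n)]
    have h4 : σ ^ (2 * n) ≤ |S / σ| ^ (12 * n) := by
      calc σ ^ (2 * n) = L ^ (6 * n) := by rw [hσ, ← pow_mul]; congr 1; ring
        _ ≤ ((S / σ) ^ 2) ^ (6 * n) := by gcongr
        _ = |S / σ| ^ (12 * n) := by rw [← sq_abs, ← pow_mul]; congr 1; ring
    have h5 := abs_sub_pow (2 * n) (S / σ) (T / σ)
    rw [h2]
    linarith

lemma core_bd {F : Measure ℝ} {v : ℝ} (h : CoreA F v 1) {s c : ℝ} (hs : 1 < s) (q : ℕ)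
    (hc : v / s ^ 2 / 2 + v / s ^ 3 ≤ c) :
    Bd F (fun x => |x / s| ^ q) (q.factorial * (2 * exp c)) := by
  refine ⟨by fun_prop, by positivity, (core_mom h hs q).trans (ENNReal.ofReal_le_ofReal ?_)⟩
  gcongr

lemma large_case (n : ℕ) : ∃ L0 c : ℝ, 2 ≤ L0 ∧ 0 ≤ c ∧ ∀ L, L0 ≤ L → ∀ σ, σ = L ^ 3 →
    ∀ F : Measure ℝ, IsProbabilityMeasure F → CoreA F (σ ^ 2) 1 →
    ∃ P : Measure (ℝ × ℝ), IsProbabilityMeasure P ∧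
      IsCoupling P F (gaussianReal 0 (σ ^ 2).toNNReal) ∧ Bd P (fun q => |q.1 - q.2| ^ n) c := by
  obtain ⟨C, hC, hker⟩ := kernel_exists (6 * n + 1)
  obtain ⟨C', hC', htr⟩ := transport_close C hC.le
  set m : ℕ → ℝ := fun j => (j.factorial : ℝ) * (2 * exp (3 / 2)) with hm
  set N : ℕ → ℝ := fun j => 2 ^ j * (m j + C * π) with hN
  set c : ℝ := 2 ^ n * (C * π + (C' ^ n * (2 ^ n * (1 + N (3 * n))) +
      2 ^ (2 * n) * (N (2 * n) + m (2 * n)) + N (12 * n))) with hc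
  have hm0 : ∀ j, 0 ≤ m j := fun j => by positivity
  have hN0 : ∀ j, 0 ≤ N j := fun j => by have := hm0 j; positivity
  have hc0 : 0 ≤ c := by
    have := hN0 (3 * n)
    have := hN0 (2 * n)
    have := hN0 (12 * n)
    have := hm0 (2 * n)
    positivity
  refine ⟨max 2 (4 * C'), c, le_max_left _ _, hc0, ?_⟩
  intro L hL σ hσ F hF hcore
  have hL2 : 2 ≤ L := (le_max_left _ _).trans hL
  have hLC : 4 * C' ≤ L := (le_max_right _ _).trans hL
  have hW : 1 ≤ L ^ 2 := by nlinarith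
  have hσ0 : 0 < σ := by rw [hσ]; positivity
  have hσ1 : 1 < σ := by rw [hσ]; nlinarith [pow_le_pow_left₀ (by norm_num) hL2 3]
  obtain ⟨k, k1, k2, k3, k4, k5⟩ := hker (L ^ 2) hW
  have H : IsKer C (L ^ 2) (6 * n + 1) k := ⟨k1, k2, k3, k4, k5⟩
  obtain ⟨T, hT, hTl, hTc⟩ := htr L (6 * n + 1) k H (by omega) hL2 hLC σ hσ F hF hcore
  have hK := H.prob hW
  have hS : Measurable fun q : ℝ × ℝ => q.1 + q.2 := by fun_prop
  rw [Measure.map_map hT hS] at hTl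
  have hTS : Measurable fun q : ℝ × ℝ => T (q.1 + q.2) := hT.comp hS
  have hmap : Measurable fun q : ℝ × ℝ => (q.1, T (q.1 + q.2)) := measurable_fst.prodMk hTS
  have hfst : (F.prod (kM k)).map Prod.fst = F := by rw [Measure.map_fst_prod]; simp
  have hsnd : (F.prod (kM k)).map Prod.snd = kM k := by rw [Measure.map_snd_prod]; simp
  have hexpo : σ ^ 2 / σ ^ 2 / 2 + σ ^ 2 / σ ^ 3 ≤ 3 / 2 := by
    have : σ ^ 2 / σ ^ 3 ≤ 1 := by rw [div_le_one (by positivity)]; gcongr <;> linarith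
    rw [div_self (by positivity)]; linarith
  -- moments of the three variables
  have b1 : ∀ j, Bd (F.prod (kM k)) (fun q => |q.1 / σ| ^ j) (m j) := fun j =>
    Bd.comp (X := fun x => |x / σ| ^ j) measurable_fst
      (by rw [hfst]; exact core_bd hcore hσ1 j hexpo)
  have b2 : ∀ j, j ≤ 2 * (6 * n + 1) → Bd (F.prod (kM k)) (fun q => |q.2| ^ j) (C * π) :=
    fun j hj => Bd.comp (X := fun x => |x| ^ j) measurable_snd
      (by rw [hsnd]; exact ⟨by fun_prop, by positivity, H.mom hW hj⟩)
  have b3 : ∀ j, Bd (F.prod (kM k)) (fun q => |T (q.1 + q.2) / σ| ^ j) (m j) := fun j =>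
    Bd.comp (X := fun x => |x / σ| ^ j) hTS
      (by
        have : (F.prod (kM k)).map (fun q => T (q.1 + q.2)) = _ := hTl
        rw [this]; exact core_bd (core_gauss (by positivity)) hσ1 j hexpo)
  have b4 : ∀ j, j ≤ 2 * (6 * n + 1) →
      Bd (F.prod (kM k)) (fun q => |(q.1 + q.2) / σ| ^ j) (N j) := by
    intro j hj
    refine Bd.mono (((b1 j).add (b2 j hj)).cmul (a := 2 ^ j) (by positivity)) (by fun_prop) ?_
    intro q
    rw [add_div]
    refine (abs_add_pow j _ _).trans ?_
    have hq : |q.2 / σ| ≤ |q.2| := by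
      rw [abs_div, abs_of_pos hσ0]
      exact div_le_self (abs_nonneg _) hσ1.le
    have hq2 := pow_le_pow_left₀ (abs_nonneg _) hq j
    gcongr
  refine ⟨(F.prod (kM k)).map (fun q => (q.1, T (q.1 + q.2))),
    Measure.isProbabilityMeasure_map hmap.aemeasurable, ⟨?_, ?_⟩, ?_⟩
  · rw [Measure.map_map measurable_fst hmap]
    exact hfst
  · rw [Measure.map_map measurable_snd hmap]
    exact hTl
  · have key : Bd (F.prod (kM k)) (fun q => |q.1 - T (q.1 + q.2)| ^ n) c := by
      refine Bd.mono (((b2 n (by omega)).add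
        ((((Bd.one.add (b4 (3 * n) (by omega))).cmul (a := 2 ^ n) (by positivity)).cmul
          (a := C' ^ n) (by positivity)).add
          (((b4 (2 * n) (by omega)).add (b3 (2 * n))).cmul (a := 2 ^ (2 * n)) (by positivity))
          |>.add (b4 (12 * n) (by omega)))).cmul (a := 2 ^ n) (by positivity)) (by fun_prop) ?_
      intro q
      exact cost_pw n hL2 hσ hC' (hTc (q.1 + q.2))
    refine ⟨by fun_prop, hc0, ?_⟩
    rw [lintegral_map (by fun_prop) hmap]
    exact key.2.2

lemma small_case (n : ℕ) (V : ℝ) : ∃ c : ℝ, 0 ≤ c ∧ ∀ v, 0 ≤ v → v ≤ V →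
    ∀ F : Measure ℝ, IsProbabilityMeasure F → CoreA F v 1 →
    ∃ P : Measure (ℝ × ℝ), IsProbabilityMeasure P ∧
      IsCoupling P F (gaussianReal 0 v.toNNReal) ∧ Bd P (fun q => |q.1 - q.2| ^ n) c := by
  set m : ℝ := (n.factorial : ℝ) * (2 * exp V) with hm
  refine ⟨4 ^ n * (m + m), by positivity, ?_⟩
  intro v hv hvV F hF hcore
  set γ := gaussianReal 0 v.toNNReal with hγ
  have hfst : (F.prod γ).map Prod.fst = F := by rw [Measure.map_fst_prod]; simp
  have hsnd : (F.prod γ).map Prod.snd = γ := by rw [Measure.map_snd_prod]; simp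
  have hexpo : v / 2 ^ 2 / 2 + v / 2 ^ 3 ≤ V := by linarith
  have b1 : Bd (F.prod γ) (fun q => |q.1 / 2| ^ n) m :=
    Bd.comp (X := fun x => |x / 2| ^ n) measurable_fst
      (by rw [hfst]; exact core_bd hcore (by norm_num) n hexpo)
  have b2 : Bd (F.prod γ) (fun q => |q.2 / 2| ^ n) m :=
    Bd.comp (X := fun x => |x / 2| ^ n) measurable_snd
      (by rw [hsnd]; exact core_bd (core_gauss hv) (by norm_num) n hexpo)
  refine ⟨F.prod γ, inferInstance, ⟨hfst, hsnd⟩, ?_⟩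
  refine Bd.mono ((b1.add b2).cmul (a := 4 ^ n) (by positivity)) (by fun_prop) ?_
  intro q
  refine (abs_sub_pow n _ _).trans (le_of_eq ?_)
  rw [abs_div, abs_div, div_pow, div_pow, abs_of_pos (by norm_num : (0:ℝ) < 2),
    show (4:ℝ) ^ n = 2 ^ n * 2 ^ n by rw [← mul_pow]; norm_num]
  field_simp

lemma unit_case (n : ℕ) : ∃ c : ℝ, 0 ≤ c ∧ ∀ v, 0 ≤ v →
    ∀ F : Measure ℝ, IsProbabilityMeasure F → CoreA F v 1 →
    ∃ P : Measure (ℝ × ℝ), IsProbabilityMeasure P ∧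
      IsCoupling P F (gaussianReal 0 v.toNNReal) ∧ Bd P (fun q => |q.1 - q.2| ^ n) c := by
  obtain ⟨L0, c1, hL0, hc1, h1⟩ := large_case n
  obtain ⟨c2, hc2, h2⟩ := small_case n (L0 ^ 6)
  refine ⟨max c1 c2, hc1.trans (le_max_left _ _), ?_⟩
  intro v hv F hF hcore
  rcases le_total v (L0 ^ 6) with h | h
  · obtain ⟨P, hP, hPc, hb⟩ := h2 v hv h F hF hcore
    exact ⟨P, hP, hPc, hb.le (le_max_right _ _)⟩
  · set L : ℝ := v ^ ((1 : ℝ) / 6) with hL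
    have hL0' : 0 ≤ L := Real.rpow_nonneg hv _
    have hL6 : L ^ 6 = v := by
      rw [hL, ← Real.rpow_natCast, ← Real.rpow_mul hv]; norm_num
    have hLL : L0 ≤ L := by
      rw [← hL6] at h
      exact le_of_pow_le_pow_left₀ (by norm_num) hL0' h
    have hv' : (L ^ 3) ^ 2 = v := by rw [← hL6]; ring
    obtain ⟨P, hP, hPc, hb⟩ := h1 L hLL (L ^ 3) rfl F hF (by rw [hv']; exact hcore)
    rw [hv'] at hPc
    exact ⟨P, hP, hPc, hb.le (le_max_left _ _)⟩


lemma final_step (p : ℝ) (hp : 1 ≤ p) : ∃ c : ℝ, 0 < c ∧ ∀ τ : ℝ, 0 < τ →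
    ∀ F : Measure ℝ, IsProbabilityMeasure F → (∫ x : ℝ, x ∂F) = 0 → MemA1 τ F →
    ∃ P : Measure (ℝ × ℝ), IsProbabilityMeasure P ∧
      IsCoupling P F (gaussianReal 0 (Real.toNNReal (variance id F))) ∧
      (∫ q : ℝ × ℝ, |q.1 - q.2| ^ p ∂P) ^ (1 / p) ≤ c * τ := by
  obtain ⟨c0, hc0, h⟩ := unit_case ⌈p⌉₊
  have hp0 : 0 < p := by linarith
  have hmeas : Measurable fun q : ℝ × ℝ => |q.1 - q.2| ^ p := by fun_prop
  refine ⟨(1 + c0) ^ (1 / p), by positivity, ?_⟩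
  intro τ hτ F hF hmean ⟨φ, hφ⟩
  have hcore := core_scale F _ τ hτ (core_of_cgf φ τ hτ F hmean hφ)
  set v := variance id F with hv
  have hv0 : 0 ≤ v := variance_nonneg _ _
  have hF' : IsProbabilityMeasure (F.map fun x => x / τ) :=
    Measure.isProbabilityMeasure_map (by fun_prop)
  obtain ⟨P, hP, ⟨hP1, hP2⟩, hb⟩ := h (v / τ ^ 2) (by positivity) _ hF' hcore
  have hm : Measurable fun q : ℝ × ℝ => (τ * q.1, τ * q.2) := by fun_prop
  refine ⟨P.map fun q => (τ * q.1, τ * q.2), Measure.isProbabilityMeasure_map hm.aemeasurable,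
    ⟨?_, ?_⟩, ?_⟩
  · rw [Measure.map_map measurable_fst hm]
    have : (Prod.fst ∘ fun q : ℝ × ℝ => (τ * q.1, τ * q.2)) = (fun x => τ * x) ∘ Prod.fst := rfl
    rw [this, ← Measure.map_map (by fun_prop) measurable_fst, hP1,
      Measure.map_map (by fun_prop) (by fun_prop)]
    have : ((fun x => τ * x) ∘ fun x => x / τ) = id := by
      ext x; simp; field_simp
    rw [this, Measure.map_id]
  · rw [Measure.map_map measurable_snd hm]
    have : (Prod.snd ∘ fun q : ℝ × ℝ => (τ * q.1, τ * q.2)) = (fun x => τ * x) ∘ Prod.snd := rfl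
    rw [this, ← Measure.map_map (by fun_prop) measurable_snd, hP2, gaussianReal_map_const_mul,
      mul_zero]
    congr 1
    ext
    push_cast
    rw [Real.coe_toNNReal _ (by positivity), Real.coe_toNNReal _ hv0]
    field_simp
  · rw [integral_map hm.aemeasurable hmeas.aestronglyMeasurable]
    have e1 : ∀ q : ℝ × ℝ, |τ * q.1 - τ * q.2| ^ p = τ ^ p * |q.1 - q.2| ^ p := by
      intro q
      rw [← mul_sub, abs_mul, abs_of_pos hτ, Real.mul_rpow hτ.le (abs_nonneg _)]
    simp_rw [e1]
    rw [integral_const_mul]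
    have hIntg : ∫ q : ℝ × ℝ, |q.1 - q.2| ^ p ∂P ≤ 1 + c0 := by
      rw [integral_eq_lintegral_of_nonneg_ae (ae_of_all _ fun q => by positivity)
        hmeas.aestronglyMeasurable]
      have hB := (Bd.one (P := P)).add hb
      have : Bd P (fun q => |q.1 - q.2| ^ p) (1 + c0) := by
        refine hB.mono (by fun_prop) fun q => ?_
        rcases le_total |q.1 - q.2| 1 with h1 | h1
        · have := Real.rpow_le_one (abs_nonneg _) h1 hp0.le
          have : 0 ≤ |q.1 - q.2| ^ ⌈p⌉₊ := by positivity
          linarith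
        · have := Real.rpow_le_rpow_of_exponent_le h1 (Nat.le_ceil p)
          rw [Real.rpow_natCast] at this
          linarith
      exact ENNReal.toReal_le_of_le_ofReal (by positivity) this.2.2
    have hi0 : 0 ≤ ∫ q : ℝ × ℝ, |q.1 - q.2| ^ p ∂P := integral_nonneg fun q => by positivity
    rw [Real.mul_rpow (by positivity) hi0, ← Real.rpow_mul hτ.le, mul_one_div_cancel hp0.ne',
      Real.rpow_one, mul_comm]
    gcongr

end aux

/-- `W_p(F, Φ_F) ≤ c(p) τ` for distributions `F ∈ A₁(τ)` with mean zero: there is a coupling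
`π` of `F` and `Φ_F` with `(∫ |x - y|^p dπ)^(1/p) ≤ c(p) τ`. -/
theorem wassersteinP_estimate_A1 :
    ∀ p : ℝ, 1 ≤ p →
      ∃ c : ℝ, 0 < c ∧
        ∀ (τ : ℝ), 0 < τ →
          ∀ (F : Measure ℝ), IsProbabilityMeasure F → (∫ x : ℝ, x ∂F) = 0 → MemA1 τ F →
            ∃ π : Measure (ℝ × ℝ), IsProbabilityMeasure π ∧
              IsCoupling π F (gaussianReal 0 (Real.toNNReal (variance id F))) ∧
              (∫ q : ℝ × ℝ, |q.1 - q.2| ^ p ∂π) ^ (1 / p) ≤ c * τ := by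
  exact final_step
end
end

section
/- There exists an absolute constant c > 0 such that for every λ > 0 there exists a coupling π of the Poisson distribution Π_λ with parameter λ and the Gaussian distribution with mean λ and variance λ satisfying ∫ (exp(|x − y|/c) − 1) dπ(x,y) ≤ 1; equivalently, sup over λ > 0 of W_ψ(Π_λ, Φ_{Π_λ}) ≤ c for the Orlicz function ψ(x) = exp(|x|) − 1. -/
open MeasureTheory ProbabilityTheory
open scoped NNReal

noncomputable section

/-- The Poisson distribution with parameter `lam`, as a measure on `ℝ`. -/
def poissonReal (lam : ℝ≥0) : Measure ℝ :=
  ((poissonPMF lam).toMeasure).map (fun n : ℕ => (n : ℝ))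

open Set Filter Topology

/-- Sign-change lemma. -/
lemma nonneg_of_signs {D g e : ℝ → ℝ} {l : ℝ}
    (hD : ∀ t, 0 < t → HasDerivAt D (g t * e t) t) (hg : ∀ t, 0 < t → 0 ≤ g t)
    (he : AntitoneOn e (Ioi 0)) (h0 : Tendsto D (𝓝[>] 0) (𝓝 l)) (hl : 0 ≤ l)
    (hT : Tendsto D atTop (𝓝 0)) {t : ℝ} (ht : 0 < t) : 0 ≤ D t := by
  rcases le_total 0 (e t) with h | h
  · have hm : MonotoneOn D (Ioc 0 t) := by
      apply monotoneOn_of_deriv_nonneg (convex_Ioc 0 t)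
      · exact fun x hx => (hD x hx.1).continuousAt.continuousWithinAt
      · intro x hx
        rw [interior_Ioc] at hx
        exact (hD x hx.1).differentiableAt.differentiableWithinAt
      · intro x hx
        rw [interior_Ioc] at hx
        rw [(hD x hx.1).deriv]
        exact mul_nonneg (hg x hx.1) (h.trans (he hx.1 ht hx.2.le))
    refine hl.trans (le_of_tendsto h0 ?_)
    filter_upwards [Ioc_mem_nhdsGT ht] with x hx
    exact hm hx ⟨ht, le_rfl⟩ hx.2
  · have hm : AntitoneOn D (Ici t) := by
      apply antitoneOn_of_deriv_nonpos (convex_Ici t)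
      · exact fun x hx => (hD x (ht.trans_le hx)).continuousAt.continuousWithinAt
      · intro x hx
        rw [interior_Ici] at hx
        exact (hD x (ht.trans hx)).differentiableAt.differentiableWithinAt
      · intro x hx
        rw [interior_Ici] at hx
        rw [(hD x (ht.trans hx)).deriv]
        exact mul_nonpos_of_nonneg_of_nonpos (hg x (ht.trans hx))
          ((he ht (mem_Ioi.2 (ht.trans hx)) (le_of_lt hx)).trans h)
    refine le_of_tendsto hT ?_
    filter_upwards [eventually_ge_atTop t] with x hx
    exact hm (mem_Ici.2 le_rfl) hx hx

/-- Standard normal CDF. -/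
def Phi (z : ℝ) : ℝ := (gaussianReal 0 1).real (Iic z)

lemma Phi_hasDerivAt (z : ℝ) : HasDerivAt Phi (gaussianPDFReal 0 1 z) z := by
  have hi := integrable_gaussianPDFReal 0 1
  have hc : Continuous (gaussianPDFReal 0 1) := by
    rw [gaussianPDFReal_def]; fun_prop
  have h1 : ∀ x, Phi x = ∫ y in Iic x, gaussianPDFReal 0 1 y := by
    intro x
    rw [Phi, measureReal_def, gaussianReal_apply_eq_integral _ one_ne_zero, ENNReal.toReal_ofReal]
    exact integral_nonneg (fun y => gaussianPDFReal_nonneg _ _ _)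
  have h2 : Phi = fun x => Phi 0 + ∫ y in (0:ℝ)..x, gaussianPDFReal 0 1 y := by
    ext x
    rw [h1, h1, ← intervalIntegral.integral_Iic_sub_Iic hi.integrableOn hi.integrableOn]
    ring
  rw [h2]
  exact (intervalIntegral.integral_hasDerivAt_right (hc.intervalIntegrable _ _)
    (hc.stronglyMeasurableAtFilter _ _) hc.continuousAt).const_add _

lemma Phi_strictMono : StrictMono Phi := by
  apply strictMono_of_deriv_pos
  intro x
  rw [(Phi_hasDerivAt x).deriv]
  exact gaussianPDFReal_pos _ _ _ one_ne_zero

lemma Phi_continuous : Continuous Phi :=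
  continuous_iff_continuousAt.2 fun x => (Phi_hasDerivAt x).continuousAt

lemma Phi_eq : Phi = fun x => cdf (gaussianReal 0 1) x := by
  ext x; rw [cdf_eq_real]; rfl

lemma Phi_atTop : Tendsto Phi atTop (𝓝 1) := by
  rw [Phi_eq]; exact tendsto_cdf_atTop _

lemma Phi_atBot : Tendsto Phi atBot (𝓝 0) := by
  rw [Phi_eq]; exact tendsto_cdf_atBot _

lemma Phi_le_one (x : ℝ) : Phi x ≤ 1 := measureReal_le_one

lemma Phi_lt_one (x : ℝ) : Phi x < 1 :=
  (Phi_strictMono (lt_add_one x)).trans_le (Phi_le_one _)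

lemma Phi_surj {p : ℝ} (h0 : 0 < p) (h1 : p < 1) : ∃ z, Phi z = p := by
  obtain ⟨a, ha⟩ := (Phi_atBot.eventually (gt_mem_nhds h0)).exists
  obtain ⟨b, hb⟩ := (Phi_atTop.eventually (lt_mem_nhds h1)).exists
  exact mem_range_of_exists_le_of_exists_ge Phi_continuous ⟨a, ha.le⟩ ⟨b, hb.le⟩

/-- Poisson CDF. -/
def Fp (k : ℕ) (x : ℝ) : ℝ := ∑ i ∈ Finset.range (k + 1), Real.exp (-x) * x ^ i / (i.factorial : ℝ)

lemma Fp_hasDerivAt (k : ℕ) (x : ℝ) :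
    HasDerivAt (Fp k) (-(Real.exp (-x) * x ^ k / (k.factorial : ℝ))) x := by
  have he : HasDerivAt (fun x : ℝ => Real.exp (-x)) (-Real.exp (-x)) x := by
    simpa using (hasDerivAt_neg x).exp
  induction k with
  | zero =>
    have : Fp 0 = fun x => Real.exp (-x) := by ext y; simp [Fp]
    rw [this]; simpa using he
  | succ k ih =>
    have h : Fp (k + 1) = fun x => Fp k x + Real.exp (-x) * x ^ (k + 1) / ((k + 1).factorial : ℝ) := by
      ext y; rw [Fp, Finset.sum_range_succ]; rfl
    rw [h]
    refine (ih.add ((he.mul (hasDerivAt_pow (k + 1) x)).div_const _)).congr_deriv ?_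
    rw [Nat.factorial_succ]
    have : (k.factorial : ℝ) ≠ 0 := by positivity
    push_cast
    field_simp
    simp

lemma Fp_zero (k : ℕ) : Fp k 0 = 1 := by
  rw [Fp, Finset.sum_range_succ']
  simp

lemma Fp_continuous (k : ℕ) : Continuous (Fp k) :=
  continuous_iff_continuousAt.2 fun x => (Fp_hasDerivAt k x).continuousAt

lemma Fp_atTop (k : ℕ) : Tendsto (Fp k) atTop (𝓝 0) := by
  have : Tendsto (Fp k) atTop (𝓝 (∑ i ∈ Finset.range (k + 1), (0 : ℝ))) := by
    apply tendsto_finsetSum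
    intro i _
    have := (Real.tendsto_pow_mul_exp_neg_atTop_nhds_zero i).div_const (i.factorial : ℝ)
    rw [zero_div] at this
    simpa only [mul_comm] using this
  simpa using this

lemma sq_atTop : Tendsto (fun t : ℝ => t ^ 2) atTop atTop := tendsto_pow_atTop two_ne_zero

lemma Fp_sq_hasDerivAt (k : ℕ) (t : ℝ) : HasDerivAt (fun t => Fp k (t ^ 2))
    (-(2 * Real.exp (-t ^ 2) * t ^ (2 * k + 1) / (k.factorial : ℝ))) t := by
  refine ((Fp_hasDerivAt k (t ^ 2)).comp t (hasDerivAt_pow 2 t)).congr_deriv ?_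
  rw [← pow_mul, pow_succ]; push_cast; ring

lemma antitone_of_log {L L' : ℝ → ℝ} (hL : ∀ t, 0 < t → HasDerivAt L (L' t) t)
    (h : ∀ t, 0 < t → L' t ≤ 0) : AntitoneOn L (Ioi 0) := by
  apply antitoneOn_of_deriv_nonpos (convex_Ioi 0)
  · exact fun x hx => (hL x hx).continuousAt.continuousWithinAt
  · intro x hx
    rw [interior_Ioi] at hx
    exact (hL x hx).differentiableAt.differentiableWithinAt
  · intro x hx
    rw [interior_Ioi] at hx
    rw [(hL x hx).deriv]; exact h x hx

lemma pdf_eq (z : ℝ) : gaussianPDFReal 0 1 z = (√(2 * Real.pi))⁻¹ * Real.exp (-z ^ 2 / 2) := by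
  simp [gaussianPDFReal]

lemma pow_eq_exp {t : ℝ} (ht : 0 < t) (n : ℕ) : t ^ n = Real.exp (n * Real.log t) := by
  rw [Real.exp_nat_mul, Real.exp_log ht]

lemma lower (k : ℕ) {t : ℝ} (ht : 0 < t) :
    Phi (2 * (√((k : ℝ) + 1 / 2) - t)) ≤ Fp k (t ^ 2) := by
  set a := √((k : ℝ) + 1 / 2) with ha
  have ha2 : a ^ 2 = (k : ℝ) + 1 / 2 := Real.sq_sqrt (by positivity)
  set S := √(2 * Real.pi) with hS
  have hSpos : 0 < S := by positivity
  let C : ℝ := S * Real.exp (2 * a ^ 2) / (k.factorial : ℝ)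
  have hC : 0 < C := by positivity
  let L : ℝ → ℝ := fun t => 4 * a * t - (2 * k + 1 : ℕ) * Real.log t - t ^ 2
  let g : ℝ → ℝ := fun t => 2 * (S⁻¹ * Real.exp (-(2 * (a - t)) ^ 2 / 2))
  have hL : AntitoneOn L (Ioi 0) := by
    apply antitone_of_log (L' := fun t => 4 * a - (2 * k + 1 : ℕ) * t⁻¹ - 2 * t)
    · intro t ht
      have h1 := ((hasDerivAt_id t).const_mul (4 * a)).sub
        ((Real.hasDerivAt_log ht.ne').const_mul (((2 * k + 1 : ℕ)) : ℝ))
      refine (h1.sub (hasDerivAt_pow 2 t)).congr_deriv ?_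
      simp
    · intro t ht
      have : 4 * a - (2 * k + 1 : ℕ) * t⁻¹ - 2 * t = -(2 * (t - a) ^ 2) / t := by
        have : ((2 * k + 1 : ℕ) : ℝ) = 2 * a ^ 2 := by rw [ha2]; push_cast; ring
        rw [this]; field_simp; ring
      rw [this]
      apply div_nonpos_of_nonpos_of_nonneg _ ht.le
      nlinarith [sq_nonneg (t - a)]
  have := nonneg_of_signs (D := fun t => Fp k (t ^ 2) - Phi (2 * (a - t))) (g := g)
    (e := fun t => 1 - C * Real.exp (-L t)) (l := 1 - Phi (2 * a)) ?_ ?_ ?_ ?_ ?_ ?_ ht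
  · simpa using this
  · intro t ht
    have h1 : HasDerivAt (fun t => 2 * (a - t)) (-2) t := by
      simpa using ((hasDerivAt_id t).const_sub a).const_mul 2
    refine ((Fp_sq_hasDerivAt k t).sub ((Phi_hasDerivAt _).comp t h1)).congr_deriv ?_
    rw [pdf_eq, pow_eq_exp ht (2 * k + 1)]
    have : g t * (C * Real.exp (-L t)) =
        2 * Real.exp (-t ^ 2) * Real.exp ((2 * k + 1 : ℕ) * Real.log t) / (k.factorial : ℝ) := by
      have h3 : Real.exp (-(2 * (a - t)) ^ 2 / 2) * Real.exp (2 * a ^ 2) * Real.exp (-L t) =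
          Real.exp (-t ^ 2) * Real.exp ((2 * k + 1 : ℕ) * Real.log t) := by
        rw [← Real.exp_add, ← Real.exp_add, ← Real.exp_add]
        congr 1; simp only [L]; ring
      simp only [g, C]
      rw [mul_assoc 2 (Real.exp (-t ^ 2)), ← h3]
      field_simp
    rw [mul_sub (g t), this]
    simp only [g]; ring
  · intro t ht; positivity
  · intro x hx y hy hxy
    have := hL hx hy hxy
    have : Real.exp (-L x) ≤ Real.exp (-L y) := by gcongr
    have : C * Real.exp (-L x) ≤ C * Real.exp (-L y) := by gcongr
    simp only; linarith
  · have : Continuous (fun t => Fp k (t ^ 2) - Phi (2 * (a - t))) :=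
      ((Fp_continuous k).comp (by fun_prop)).sub (Phi_continuous.comp (by fun_prop))
    have := this.tendsto 0
    simp only [ne_eq, OfNat.ofNat_ne_zero, not_false_eq_true, zero_pow, Fp_zero, sub_zero] at this
    exact this.mono_left nhdsWithin_le_nhds
  · linarith [Phi_le_one (2 * a)]
  · have h1 : Tendsto (fun t : ℝ => 2 * (a - t)) atTop atBot := by
      apply Tendsto.const_mul_atBot two_pos
      exact tendsto_atBot_add_const_left _ a tendsto_neg_atTop_atBot
    simpa using ((Fp_atTop k).comp sq_atTop).sub (Phi_atBot.comp h1)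

lemma upper (k : ℕ) {t : ℝ} (ht : 0 < t) :
    Fp k (t ^ 2) ≤ Phi (((k : ℝ) + 3 / 2) / t - t) := by
  set m : ℝ := (k : ℝ) + 3 / 2 with hm
  have hm0 : 0 < m := by positivity
  set S := √(2 * Real.pi) with hS
  have hSpos : 0 < S := by positivity
  let C : ℝ := 2 * S * Real.exp (-m) / (k.factorial : ℝ)
  have hC : 0 < C := by positivity
  let L : ℝ → ℝ := fun t => (2 * k + 3 : ℕ) * Real.log t + m ^ 2 / 2 * (t ^ 2)⁻¹ - t ^ 2 / 2
    - Real.log (m + t ^ 2)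
  let g : ℝ → ℝ := fun t => (m / t ^ 2 + 1) * (S⁻¹ * Real.exp (-(m / t - t) ^ 2 / 2))
  have hL : AntitoneOn L (Ioi 0) := by
    apply antitone_of_log (L' := fun t => (2 * k + 3 : ℕ) * t⁻¹ - m ^ 2 / t ^ 3 - t
      - 2 * t / (m + t ^ 2))
    · intro t ht
      have h1 := (Real.hasDerivAt_log ht.ne').const_mul (((2 * k + 3 : ℕ)) : ℝ)
      have h2 := ((hasDerivAt_pow 2 t).inv (by positivity)).const_mul (m ^ 2 / 2)
      have h3 := (hasDerivAt_pow 2 t).div_const 2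
      have h4 := ((hasDerivAt_pow 2 t).const_add m).log (by positivity)
      refine (((h1.add h2).sub h3).sub h4).congr_deriv ?_
      simp
      field_simp
      ring
    · intro t ht
      have : (2 * k + 3 : ℕ) * t⁻¹ - m ^ 2 / t ^ 3 - t - 2 * t / (m + t ^ 2)
          = -((t ^ 2 - m) ^ 2 * (t ^ 2 + m) + 2 * t ^ 4) / (t ^ 3 * (m + t ^ 2)) := by
        have : ((2 * k + 3 : ℕ) : ℝ) = 2 * m := by rw [hm]; push_cast; ring
        rw [this]; field_simp; ring
      rw [this]
      apply div_nonpos_of_nonpos_of_nonneg _ (by positivity)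
      have : 0 ≤ (t ^ 2 - m) ^ 2 * (t ^ 2 + m) + 2 * t ^ 4 := by positivity
      linarith
  have := nonneg_of_signs (D := fun t => Phi (m / t - t) - Fp k (t ^ 2)) (g := g)
    (e := fun t => C * Real.exp (L t) - 1) (l := 0) ?_ ?_ ?_ ?_ le_rfl ?_ ht
  · simpa using this
  · intro t ht
    have h1 : HasDerivAt (fun t => m / t - t) (-(m / t ^ 2 + 1)) t := by
      refine (((hasDerivAt_inv ht.ne').const_mul m).sub (hasDerivAt_id t)).congr_deriv ?_
      ring
    refine (((Phi_hasDerivAt _).comp t h1).sub (Fp_sq_hasDerivAt k t)).congr_deriv ?_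
    rw [pdf_eq]
    have : g t * (C * Real.exp (L t)) =
        2 * Real.exp (-t ^ 2) * t ^ (2 * k + 1) / (k.factorial : ℝ) := by
      have h3 : Real.exp (-(m / t - t) ^ 2 / 2) * Real.exp (-m) * Real.exp (L t) =
          Real.exp (-t ^ 2) * t ^ (2 * k + 3) / (m + t ^ 2) := by
        have h5 := Real.exp_log (show 0 < m + t ^ 2 by positivity)
        rw [pow_eq_exp ht (2 * k + 3), eq_div_iff (by positivity)]
        conv_lhs => rw [← h5]
        rw [← Real.exp_add, ← Real.exp_add, ← Real.exp_add, ← Real.exp_add]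
        congr 1; simp only [L]; field_simp; ring
      have h4 : g t * (C * Real.exp (L t)) = 2 * (m / t ^ 2 + 1) / (k.factorial : ℝ) *
        (Real.exp (-(m / t - t) ^ 2 / 2) * Real.exp (-m) * Real.exp (L t)) := by
        simp only [g, C]
        field_simp
      rw [h4, h3]
      field_simp
      ring
    rw [mul_sub (g t), this]
    simp only [g]; ring
  · intro t ht; positivity
  · intro x hx y hy hxy
    have := hL hx hy hxy
    have : Real.exp (L y) ≤ Real.exp (L x) := by gcongr
    have : C * Real.exp (L y) ≤ C * Real.exp (L x) := by gcongr
    simp only; linarith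
  · have h1 : Tendsto (fun t => Fp k (t ^ 2)) (𝓝[>] 0) (𝓝 1) := by
      have := ((Fp_continuous k).comp (continuous_pow 2)).tendsto 0
      simp only [Function.comp, ne_eq, OfNat.ofNat_ne_zero, not_false_eq_true, zero_pow, Fp_zero] at this
      exact this.mono_left nhdsWithin_le_nhds
    have h2 : Tendsto (fun t : ℝ => m / t - t) (𝓝[>] 0) atTop := by
      have h3 : Tendsto (fun t : ℝ => m / t) (𝓝[>] 0) atTop :=
        Tendsto.const_mul_atTop hm0 tendsto_inv_nhdsGT_zero
      have h4 : Tendsto (fun t : ℝ => -t) (𝓝[>] 0) (𝓝 (-0)) :=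
        (continuous_neg.tendsto 0).mono_left nhdsWithin_le_nhds
      exact h3.atTop_add h4
    simpa using (Phi_atTop.comp h2).sub h1
  · have h2 : Tendsto (fun t : ℝ => m / t - t) atTop atBot := by
      have h3 : Tendsto (fun t : ℝ => m / t) atTop (𝓝 0) := tendsto_const_nhds.div_atTop tendsto_id
      exact h3.add_atBot tendsto_neg_atTop_atBot
    simpa using (Phi_atBot.comp h2).sub ((Fp_atTop k).comp sq_atTop)

lemma Fp_tendsto (lam : ℝ≥0) : Tendsto (fun k => Fp k lam) atTop (𝓝 1) :=
  ((hasSum_one_poissonMeasure lam).tendsto_sum_nat).comp (tendsto_add_atTop_nat 1)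

lemma Fp_strict {x : ℝ} (hx : 0 < x) : StrictMono (fun k => Fp k x) := by
  apply strictMono_nat_of_lt_succ
  intro k
  have : Fp (k + 1) x = Fp k x + Real.exp (-x) * x ^ (k + 1) / ((k + 1).factorial : ℝ) := by
    rw [Fp, Finset.sum_range_succ]; rfl
  rw [this]
  have : 0 < Real.exp (-x) * x ^ (k + 1) / ((k + 1).factorial : ℝ) := by positivity
  linarith

lemma Fp_pos {x : ℝ} (hx : 0 < x) (k : ℕ) : 0 < Fp k x :=
  Finset.sum_pos (fun i _ => by positivity) ⟨0, by simp⟩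

lemma Fp_lt_one {lam : ℝ≥0} (hx : 0 < lam) (k : ℕ) : Fp k lam < 1 :=
  (Fp_strict (NNReal.coe_pos.2 hx) (Nat.lt_succ_self k)).trans_le
    ((Fp_strict (NNReal.coe_pos.2 hx)).monotone.ge_of_tendsto (Fp_tendsto lam) _)

lemma exists_le (lam : ℝ≥0) (z : ℝ) : ∃ k, Phi z ≤ Fp k lam :=
  (((Fp_tendsto lam).eventually (lt_mem_nhds (Phi_lt_one z))).exists).imp fun _ h => h.le

open Classical in
/-- Quantile transform. -/
def Xq (lam : ℝ≥0) (z : ℝ) : ℕ := Nat.find (exists_le lam z)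

lemma Xq_spec (lam : ℝ≥0) (z : ℝ) : Phi z ≤ Fp (Xq lam z) lam := by
  classical exact Nat.find_spec (exists_le lam z)

lemma Xq_lt (lam : ℝ≥0) (z : ℝ) {k : ℕ} (h : k < Xq lam z) : Fp k lam < Phi z := by
  classical exact not_le.1 (Nat.find_min (exists_le lam z) h)

lemma Xq_le_iff {lam : ℝ≥0} (hl : 0 < lam) (z : ℝ) (k : ℕ) : Xq lam z ≤ k ↔ Phi z ≤ Fp k lam := by
  constructor
  · intro h
    exact (Xq_spec lam z).trans ((Fp_strict (NNReal.coe_pos.2 hl)).monotone h)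
  · intro h
    by_contra hc
    exact absurd h (not_le.2 (Xq_lt lam z (not_le.1 hc)))

lemma Xq_measurable {lam : ℝ≥0} (hl : 0 < lam) : Measurable (Xq lam) := by
  apply Monotone.measurable
  intro a b hab
  rw [Xq_le_iff hl]
  exact (Phi_strictMono.monotone hab).trans (Xq_spec lam b)

lemma Xq_law {lam : ℝ≥0} (hl : 0 < lam) :
    (gaussianReal 0 1).map (Xq lam) = (poissonPMF lam).toMeasure := by
  have : IsProbabilityMeasure ((gaussianReal 0 1).map (Xq lam)) :=
    Measure.isProbabilityMeasure_map (Xq_measurable hl).aemeasurable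
  apply Measure.ext_of_Iic
  intro k
  have hpos := NNReal.coe_pos.2 hl
  rw [Measure.map_apply (Xq_measurable hl) measurableSet_Iic]
  obtain ⟨w, hw⟩ := Phi_surj (Fp_pos hpos k) (Fp_lt_one hl k)
  have h1 : Xq lam ⁻¹' Iic k = Iic w := by
    ext z
    simp only [mem_preimage, mem_Iic]
    rw [Xq_le_iff hl, ← hw, Phi_strictMono.le_iff_le]
  have h2 : (Iic k : Set ℕ) = ↑(Finset.range (k + 1)) := by ext; simp
  rw [h1, h2, PMF.toMeasure_apply_finset]
  have h3 : ∀ i, poissonPMF lam i = ENNReal.ofReal (Real.exp (-lam) * lam ^ i / (i.factorial : ℝ)) :=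
    fun i => rfl
  simp_rw [h3]
  rw [← ENNReal.ofReal_sum_of_nonneg (fun i _ => by positivity)]
  change _ = ENNReal.ofReal (Fp k lam)
  rw [← hw, Phi, ofReal_measureReal]

lemma Xq_bound {lam : ℝ≥0} (hl : 0 < lam) (z : ℝ) :
    |(Xq lam z : ℝ) - (√(lam : ℝ) * z + lam)| ≤ 3 / 2 + z ^ 2 / 4 := by
  set t := √(lam : ℝ) with ht
  have hpos := NNReal.coe_pos.2 hl
  have ht0 : 0 < t := Real.sqrt_pos.2 hpos
  have ht2 : t ^ 2 = lam := Real.sq_sqrt hpos.le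
  rw [abs_le]
  constructor
  · have h1 := (Xq_spec lam z)
    rw [← ht2] at h1
    have h2 := Phi_strictMono.le_iff_le.1 (h1.trans (upper (Xq lam z) ht0))
    rw [le_sub_iff_add_le, le_div_iff₀ ht0] at h2
    nlinarith [sq_nonneg z]
  · rcases Nat.eq_zero_or_pos (Xq lam z) with h | h
    · rw [h, ← ht2]; push_cast; nlinarith [sq_nonneg (t + z / 2)]
    · obtain ⟨j, hj⟩ := Nat.exists_eq_succ_of_ne_zero h.ne'
      have h1 := Xq_lt lam z (k := j) (by omega)
      rw [← ht2] at h1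
      have h2 := Phi_strictMono.lt_iff_lt.1 ((lower j ht0).trans_lt h1)
      have h3 : (√((j : ℝ) + 1 / 2)) ^ 2 = (j : ℝ) + 1 / 2 := Real.sq_sqrt (by positivity)
      have h4 := Real.sqrt_nonneg ((j : ℝ) + 1 / 2)
      have h5 : (√((j : ℝ) + 1 / 2)) ^ 2 ≤ (t + z / 2) ^ 2 := by
        apply pow_le_pow_left₀ h4; linarith
      rw [hj, ← ht2]; push_cast
      nlinarith

lemma exp_sq_int : Integrable (fun z : ℝ => Real.exp (z ^ 2 / 16)) (gaussianReal 0 1) ∧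
    ∫ z, Real.exp (z ^ 2 / 16) ∂(gaussianReal 0 1) = √(8 / 7) := by
  have h : ∀ z : ℝ, gaussianPDFReal 0 1 z • Real.exp (z ^ 2 / 16) =
      (√(2 * Real.pi))⁻¹ * Real.exp (-(7 / 16) * z ^ 2) := by
    intro z
    rw [pdf_eq, smul_eq_mul, mul_assoc, ← Real.exp_add]
    congr 2; ring
  constructor
  · rw [gaussianReal_of_var_ne_zero _ one_ne_zero,
      integrable_withDensity_iff_integrable_smul' (measurable_gaussianPDF _ _)
        (ae_of_all _ fun _ => gaussianPDF_lt_top)]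
    simp_rw [toReal_gaussianPDF, h]
    exact (integrable_exp_neg_mul_sq (by norm_num)).const_mul _
  · rw [integral_gaussianReal_eq_integral_smul one_ne_zero]
    simp_rw [h]
    rw [integral_const_mul, integral_gaussian, ← Real.sqrt_inv, ← Real.sqrt_mul (by positivity)]
    congr 1
    field_simp
    norm_num

lemma num_bound : Real.exp (3 / 8) * √(8 / 7) ≤ 2 := by
  have h1 : Real.exp (3 / 8) ^ 2 ≤ Real.exp 1 := by
    rw [← Real.exp_nat_mul]; apply Real.exp_le_exp.2; norm_num
  have h2 := Real.exp_one_lt_d9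
  have h3 : √(8 / 7 : ℝ) ^ 2 = 8 / 7 := Real.sq_sqrt (by norm_num)
  rw [← pow_le_pow_iff_left₀ (by positivity) (by norm_num) two_ne_zero]
  rw [mul_pow, h3]
  linarith

/-- Uniform Orlicz–Wasserstein estimate for Poisson distributions: there is an absolute
constant `c` such that for every `λ > 0` there is a coupling `π` of `Π_λ` and the Gaussian
law with mean `λ` and variance `λ` with `∫ (exp(|x-y|/c) - 1) dπ ≤ 1`. -/
theorem orlicz_wasserstein_poisson :
    ∃ c : ℝ, 0 < c ∧
      ∀ lam : ℝ≥0, 0 < lam →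
        ∃ π : Measure (ℝ × ℝ), IsProbabilityMeasure π ∧
          IsCoupling π (poissonReal lam) (gaussianReal (lam : ℝ) lam) ∧
          ∫ p : ℝ × ℝ, (Real.exp (|p.1 - p.2| / c) - 1) ∂π ≤ 1 := by
  refine ⟨4, by norm_num, fun lam hl => ?_⟩
  have hX := Xq_measurable hl
  have hX' : Measurable (fun z => (Xq lam z : ℝ)) := (measurable_of_countable _).comp hX
  have hY : Measurable (fun z : ℝ => √(lam : ℝ) * z + lam) := by fun_prop
  have hXY : Measurable (fun z => ((Xq lam z : ℝ), √(lam : ℝ) * z + lam)) := hX'.prodMk hY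
  refine ⟨(gaussianReal 0 1).map (fun z => ((Xq lam z : ℝ), √(lam : ℝ) * z + lam)),
    Measure.isProbabilityMeasure_map hXY.aemeasurable, ⟨?_, ?_⟩, ?_⟩
  · rw [Measure.map_map measurable_fst hXY, poissonReal, ← Xq_law hl,
      Measure.map_map (measurable_of_countable _) hX]
    rfl
  · rw [Measure.map_map measurable_snd hXY]
    have h1 : (Prod.snd ∘ fun z => ((Xq lam z : ℝ), √(lam : ℝ) * z + lam)) =
      (fun x => x + (lam : ℝ)) ∘ (fun x => √(lam : ℝ) * x) := rfl
    rw [h1, ← Measure.map_map (by fun_prop) (by fun_prop), gaussianReal_map_const_mul,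
      gaussianReal_map_add_const]
    congr 1
    · simp
    · ext; simp
  · rw [integral_map hXY.aemeasurable (by fun_prop)]
    have h1 : ∀ z, Real.exp (|(Xq lam z : ℝ) - (√(lam : ℝ) * z + lam)| / 4) ≤
        Real.exp (3 / 8) * Real.exp (z ^ 2 / 16) := by
      intro z
      rw [← Real.exp_add]
      apply Real.exp_le_exp.2
      linarith [Xq_bound hl z]
    have hi := exp_sq_int.1.const_mul (Real.exp (3 / 8))
    have h2 : ∫ z, (Real.exp (|(Xq lam z : ℝ) - (√(lam : ℝ) * z + lam)| / 4) - 1)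
        ∂(gaussianReal 0 1) ≤
        ∫ z, (Real.exp (3 / 8) * Real.exp (z ^ 2 / 16) - 1) ∂(gaussianReal 0 1) := by
      apply integral_mono_of_nonneg
      · refine ae_of_all _ fun z => ?_
        have : (1 : ℝ) ≤ Real.exp (|(Xq lam z : ℝ) - (√(lam : ℝ) * z + lam)| / 4) :=
          Real.one_le_exp (by positivity)
        simp only [Pi.zero_apply]; linarith
      · exact hi.sub (integrable_const 1)
      · exact ae_of_all _ fun z => by linarith [h1 z]
    refine h2.trans ?_
    rw [integral_sub hi (integrable_const 1), integral_const_mul, exp_sq_int.2,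
      integral_const, probReal_univ, one_smul]
    linarith [num_bound]
end
end
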